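/- arXiv:1602.06934 — 3 statements merged into one kernel-verified Lean document; each statement's English description precedes it below -/
import Mathlib

section
/- Fix positive integers a, b and a nonnegative integer c. There exist constants c₁, c₂ > 0, depending only on a, b, c, such that for every integer n ≥ 2 and every real p ∈ [1,∞), c₁ · n^{4/p} ≤ M_p(x₁⁴)/M_p(1) ≤ c₂ · n^{4/p} and c₁ · n^{4/p} ≤ M_p(x₁² x₂²)/M_p(1) ≤ c₂ · n^{4/p}. -/
open MeasureTheory Real

/-- The density `∏_{i<j} |x_i^a - x_j^a|^b · ∏_i |x_i|^c` on `ℝⁿ`. -/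
noncomputable def fabc (n a b c : ℕ) (x : Fin n → ℝ) : ℝ :=
  (∏ i : Fin n, ∏ j : Fin n, if i < j then |x i ^ a - x j ^ a| ^ b else 1) *
    ∏ i : Fin n, |x i| ^ c

/-- `M_p(g) = ∫ g(x) f_{a,b,c}(x) exp(-‖x‖_p^p) dx`. -/
noncomputable def Mp (n a b c : ℕ) (p : ℝ) (g : (Fin n → ℝ) → ℝ) : ℝ :=
  ∫ x : Fin n → ℝ, g x * fabc n a b c x * Real.exp (-∑ i, |x i| ^ p)

lemma aux_pow_upper (u v : ℝ) (hv : 0 ≤ v) (h : v ≤ u) (k : ℕ) :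
    u ^ (k + 1) - v ^ (k + 1) ≤ (k + 1) * u ^ k * (u - v) := by
  induction k with
  | zero => simp
  | succ k ih =>
    have hu : 0 ≤ u := hv.trans h
    have h1 : v ^ (k + 1) ≤ u ^ (k + 1) := pow_le_pow_left₀ hv h _
    have h2 : u * (u ^ (k + 1) - v ^ (k + 1)) ≤ u * ((k + 1) * u ^ k * (u - v)) :=
      mul_le_mul_of_nonneg_left ih hu
    have h3 : v ^ (k + 1) * (u - v) ≤ u ^ (k + 1) * (u - v) :=
      mul_le_mul_of_nonneg_right h1 (sub_nonneg.2 h)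
    push_cast
    have e1 : u ^ (k + 1 + 1) - v ^ (k + 1 + 1)
        = u * (u ^ (k + 1) - v ^ (k + 1)) + v ^ (k + 1) * (u - v) := by ring
    have e2 : ((k : ℝ) + 1 + 1) * u ^ (k + 1) * (u - v)
        = u * ((k + 1) * u ^ k * (u - v)) + u ^ (k + 1) * (u - v) := by ring
    rw [e1, e2]
    exact add_le_add h2 h3

lemma aux_pow_lower (u v : ℝ) (hv : 0 ≤ v) (h : v ≤ u) (k : ℕ) :
    u ^ k * (u - v) ≤ u ^ (k + 1) - v ^ (k + 1) := by
  have h1 : v ^ k ≤ u ^ k := pow_le_pow_left₀ hv h _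
  have := mul_nonneg hv (sub_nonneg.2 h1)
  have e : u ^ (k + 1) - v ^ (k + 1) = u ^ k * (u - v) + v * (u ^ k - v ^ k) := by ring
  linarith

/-- The transport map in one variable. -/
noncomputable def phi (t : ℝ) (m : ℕ) (x : ℝ) : ℝ := x * (1 + t * |x| ^ m)

lemma one_add_pow_le_exp (s : ℝ) (hs : 0 ≤ s) (k : ℕ) : (1 + s) ^ k ≤ Real.exp (k * s) := by
  rw [Real.exp_nat_mul]
  exact pow_le_pow_left₀ (by linarith) (by linarith [Real.add_one_le_exp s]) _

lemma pair_bound_aux (a m : ℕ) (t : ℝ) (ht : 0 ≤ t) (x y : ℝ)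
    (h : |y| ≤ |x|) :
    |phi t (m + 1) x ^ (a + 1) - phi t (m + 1) y ^ (a + 1)| ≤
      |x ^ (a + 1) - y ^ (a + 1)| *
        Real.exp ((a + 1) * (m + 2) * t * (|x| ^ (m + 1) + |y| ^ (m + 1))) := by
  set X := |x| with hX
  set Y := |y| with hY
  have hX0 : 0 ≤ X := abs_nonneg _
  have hY0 : 0 ≤ Y := abs_nonneg _
  set α := 1 + t * X ^ (m + 1) with hα
  set β := 1 + t * Y ^ (m + 1) with hβ
  set D := |x ^ (a + 1) - y ^ (a + 1)| with hD
  have hβ1 : 1 ≤ β := by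
    have : 0 ≤ t * Y ^ (m + 1) := by positivity
    linarith
  have hβα : β ≤ α := by
    have : t * Y ^ (m + 1) ≤ t * X ^ (m + 1) := by gcongr
    linarith
  have hD1 : X ^ a * (X - Y) ≤ D := by
    refine (aux_pow_lower X Y hY0 h a).trans ?_
    have := abs_sub_abs_le_abs_sub (x ^ (a + 1)) (y ^ (a + 1))
    rwa [abs_pow, abs_pow] at this
  have hD0 : 0 ≤ D := abs_nonneg _
  have h1 : α ^ (a + 1) - β ^ (a + 1) ≤ (a + 1) * α ^ a * (α - β) :=
    aux_pow_upper α β (by linarith) hβα a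
  have h2 : α - β ≤ t * ((m + 1) * X ^ m * (X - Y)) := by
    have := mul_le_mul_of_nonneg_left (aux_pow_upper X Y hY0 h m) ht
    simp only [hα, hβ]; linarith
  have h3 : Y ^ (a + 1) * (α ^ (a + 1) - β ^ (a + 1)) ≤
      (a + 1) * α ^ a * t * (m + 1) * X ^ (m + 1) * D := by
    have hαa : 0 ≤ α ^ a := by positivity
    calc Y ^ (a + 1) * (α ^ (a + 1) - β ^ (a + 1))
        ≤ Y ^ (a + 1) * ((a + 1) * α ^ a * (t * ((m + 1) * X ^ m * (X - Y)))) := by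
          gcongr
          exact h1.trans (by gcongr)
      _ ≤ X ^ (a + 1) * ((a + 1) * α ^ a * (t * ((m + 1) * X ^ m * (X - Y)))) := by
          have : 0 ≤ X - Y := sub_nonneg.2 h
          gcongr
      _ = (a + 1) * α ^ a * t * (m + 1) * X ^ (m + 1) * (X ^ a * (X - Y)) := by ring
      _ ≤ _ := by gcongr
  have h4 : |phi t (m + 1) x ^ (a + 1) - phi t (m + 1) y ^ (a + 1)| ≤
      α ^ (a + 1) * D + Y ^ (a + 1) * (α ^ (a + 1) - β ^ (a + 1)) := by
    have e : phi t (m + 1) x ^ (a + 1) - phi t (m + 1) y ^ (a + 1)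
        = α ^ (a + 1) * (x ^ (a + 1) - y ^ (a + 1))
          + y ^ (a + 1) * (α ^ (a + 1) - β ^ (a + 1)) := by
      simp only [phi, mul_pow, ← hX, ← hY, ← hα, ← hβ]; ring
    rw [e]
    refine (abs_add_le _ _).trans ?_
    rw [abs_mul, abs_mul, abs_pow y, abs_of_nonneg (show 0 ≤ α ^ (a + 1) by positivity),
      abs_of_nonneg (sub_nonneg.2 (pow_le_pow_left₀ (by linarith) hβα (a + 1)))]
  have hs : 0 ≤ t * X ^ (m + 1) := by positivity
  have h5 : α ^ (a + 1) ≤ Real.exp ((a + 1 : ℕ) * (t * X ^ (m + 1))) :=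
    one_add_pow_le_exp _ hs _
  have h6 : α ^ a ≤ α ^ (a + 1) := pow_le_pow_right₀ (by linarith) (by omega)
  calc _ ≤ _ := h4
    _ ≤ α ^ (a + 1) * D + (a + 1) * α ^ (a + 1) * t * (m + 1) * X ^ (m + 1) * D := by
        refine add_le_add le_rfl (h3.trans ?_)
        gcongr
    _ = D * (α ^ (a + 1) * ((a + 1) * (m + 1) * (t * X ^ (m + 1)) + 1)) := by ring
    _ ≤ D * (Real.exp ((a + 1 : ℕ) * (t * X ^ (m + 1))) *
          Real.exp ((a + 1) * (m + 1) * (t * X ^ (m + 1)))) := by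
        gcongr
        exact Real.add_one_le_exp _
    _ ≤ _ := by
        rw [← Real.exp_add]
        gcongr
        have : 0 ≤ (a + 1) * (m + 2) * t * Y ^ (m + 1) := by positivity
        push_cast
        linarith

lemma pair_bound (a m : ℕ) (ha : 1 ≤ a) (hm : 1 ≤ m) (t : ℝ) (ht : 0 ≤ t) (x y : ℝ) :
    |phi t m x ^ a - phi t m y ^ a| ≤
      |x ^ a - y ^ a| * Real.exp (a * (m + 1) * t * (|x| ^ m + |y| ^ m)) := by
  obtain ⟨a, rfl⟩ := Nat.exists_eq_add_of_le' ha
  obtain ⟨m, rfl⟩ := Nat.exists_eq_add_of_le' hm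
  rcases le_total |y| |x| with h | h
  · refine (pair_bound_aux a m t ht x y h).trans (le_of_eq ?_)
    push_cast; ring_nf
  · rw [abs_sub_comm, abs_sub_comm (x ^ (a + 1))]
    refine (pair_bound_aux a m t ht y x h).trans (le_of_eq ?_)
    push_cast; ring_nf

lemma fabc_nonneg (n a b c : ℕ) (x : Fin n → ℝ) : 0 ≤ fabc n a b c x := by
  unfold fabc
  refine mul_nonneg (Finset.prod_nonneg fun i _ => Finset.prod_nonneg fun j _ => ?_)
    (Finset.prod_nonneg fun i _ => by positivity)
  split_ifs <;> positivity

lemma fabc_continuous (n a b c : ℕ) : Continuous (fabc n a b c) := by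
  unfold fabc
  refine Continuous.mul (continuous_finsetProd _ fun i _ => continuous_finsetProd _ fun j _ => ?_)
    (by fun_prop)
  split_ifs <;> fun_prop

/-- weight -/
noncomputable def gd (n a b c : ℕ) (p : ℝ) (x : Fin n → ℝ) : ℝ :=
  fabc n a b c x * Real.exp (-∑ i, |x i| ^ p)

lemma gd_nonneg (n a b c : ℕ) (p : ℝ) (x : Fin n → ℝ) : 0 ≤ gd n a b c p x :=
  mul_nonneg (fabc_nonneg ..) (Real.exp_pos _).le

lemma gd_continuous (n a b c : ℕ) (p : ℝ) (hp : 0 ≤ p) : Continuous (gd n a b c p) := by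
  unfold gd
  refine (fabc_continuous n a b c).mul (Real.continuous_exp.comp (Continuous.neg ?_))
  exact continuous_finsetSum _ fun i _ =>
    ((continuous_apply i).abs).rpow_const fun _ => Or.inr hp

lemma Mp_eq (n a b c : ℕ) (p : ℝ) (h : (Fin n → ℝ) → ℝ) :
    Mp n a b c p h = ∫ x, h x * gd n a b c p x := by
  simp only [Mp, gd, mul_assoc]

lemma fabc_le (n a b c : ℕ) (ha : 1 ≤ a) (x : Fin n → ℝ) :
    fabc n a b c x ≤ ∏ i, (1 + |x i|) ^ (2 * (a * b) * n + c) := by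
  unfold fabc
  have h1 : (∏ i : Fin n, ∏ j : Fin n, if i < j then |x i ^ a - x j ^ a| ^ b else 1) ≤
      ∏ i : Fin n, ∏ j : Fin n, ((1 + |x i|) ^ (a * b) * (1 + |x j|) ^ (a * b)) := by
    refine Finset.prod_le_prod
      (fun i _ => Finset.prod_nonneg fun j _ => by split_ifs <;> positivity) fun i _ => ?_
    refine Finset.prod_le_prod (fun j _ => by split_ifs <;> positivity) fun j _ => ?_
    have hi : 1 ≤ (1 + |x i|) := by linarith [abs_nonneg (x i)]
    have hj : 1 ≤ (1 + |x j|) := by linarith [abs_nonneg (x j)]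
    split_ifs
    · rw [pow_mul, pow_mul, ← mul_pow]
      refine pow_le_pow_left₀ (abs_nonneg _) ?_ _
      calc |x i ^ a - x j ^ a| ≤ |x i| ^ a + |x j| ^ a := by
            rw [← abs_pow, ← abs_pow]; exact abs_sub _ _
        _ ≤ (1 + |x i| ^ a) * (1 + |x j| ^ a) := by
            have : 0 ≤ |x i| ^ a * |x j| ^ a := by positivity
            nlinarith
        _ ≤ (1 + |x i|) ^ a * (1 + |x j|) ^ a := by
            have e1 := pow_add_pow_le zero_le_one (abs_nonneg (x i)) (show a ≠ 0 by omega)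
            have e2 := pow_add_pow_le zero_le_one (abs_nonneg (x j)) (show a ≠ 0 by omega)
            rw [one_pow] at e1 e2
            gcongr
    · exact one_le_mul_of_one_le_of_one_le (one_le_pow₀ hi) (one_le_pow₀ hj)
  have h2 : ∏ i : Fin n, |x i| ^ c ≤ ∏ i : Fin n, (1 + |x i|) ^ c :=
    Finset.prod_le_prod (fun i _ => by positivity) fun i _ => by gcongr; linarith
  refine (mul_le_mul h1 h2 (by positivity) (by positivity)).trans (le_of_eq ?_)
  simp only [Finset.prod_mul_distrib, Finset.prod_const, Finset.card_univ, Fintype.card_fin,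
    pow_add, Finset.prod_pow]
  ring

lemma int_1d (k : ℕ) : Integrable (fun x : ℝ => (1 + |x|) ^ k * Real.exp (1 - |x|)) := by
  have hc : Continuous (fun x : ℝ => (1 + |x|) ^ k * Real.exp (1 - |x|)) := by fun_prop
  refine (integrable_inv_one_add_sq.const_mul (((k + 2).factorial : ℝ) * Real.exp 2)).mono'
    hc.aestronglyMeasurable (Filter.Eventually.of_forall fun x => ?_)
  rw [Real.norm_of_nonneg (by positivity), ← div_eq_mul_inv, le_div_iff₀ (by positivity)]
  have h0 := abs_nonneg x
  have h1 := Real.pow_div_factorial_le_exp (x := 1 + |x|) (by positivity) (k + 2)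
  rw [div_le_iff₀ (by positivity)] at h1
  have h2 : 1 + x ^ 2 ≤ (1 + |x|) ^ 2 := by rw [← sq_abs]; nlinarith
  calc (1 + |x|) ^ k * Real.exp (1 - |x|) * (1 + x ^ 2)
      ≤ (1 + |x|) ^ k * Real.exp (1 - |x|) * (1 + |x|) ^ 2 := by gcongr
    _ = (1 + |x|) ^ (k + 2) * Real.exp (1 - |x|) := by ring
    _ ≤ (Real.exp (1 + |x|) * (k + 2).factorial) * Real.exp (1 - |x|) := by gcongr
    _ = (k + 2).factorial * (Real.exp (1 + |x|) * Real.exp (1 - |x|)) := by ring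
    _ = _ := by rw [← Real.exp_add]; norm_num

lemma exp_sum_le (n : ℕ) (p : ℝ) (hp : 1 ≤ p) (x : Fin n → ℝ) :
    Real.exp (-∑ i, |x i| ^ p) ≤ ∏ i, Real.exp (1 - |x i|) := by
  rw [← Finset.sum_neg_distrib, Real.exp_sum]
  refine Finset.prod_le_prod (fun i _ => (Real.exp_pos _).le) fun i _ => ?_
  apply Real.exp_le_exp.2
  have h0 := abs_nonneg (x i)
  rcases le_total |x i| 1 with h | h
  · have := Real.rpow_nonneg h0 p
    linarith
  · have := Real.rpow_le_rpow_of_exponent_le h hp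
    rw [Real.rpow_one] at this
    linarith

lemma int_dom (n k : ℕ) :
    Integrable (fun x : Fin n → ℝ => ∏ i, ((1 + |x i|) ^ k * Real.exp (1 - |x i|))) :=
  Integrable.fintype_prod (f := fun _ : Fin n => fun x : ℝ => (1 + |x|) ^ k * Real.exp (1 - |x|))
    (fun _ => int_1d k)

lemma int_moment (n a b c : ℕ) (ha : 1 ≤ a) (p : ℝ) (hp : 1 ≤ p) (i : Fin n) (q : ℝ)
    (hq : 0 ≤ q) : Integrable (fun x : Fin n → ℝ => |x i| ^ q * gd n a b c p x) := by
  obtain ⟨k, hk⟩ := exists_nat_ge q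
  have hc : Continuous (fun x : Fin n → ℝ => |x i| ^ q * gd n a b c p x) :=
    (((continuous_apply i).abs).rpow_const fun _ => Or.inr hq).mul
      (gd_continuous n a b c p (by linarith))
  refine (int_dom n (k + (2 * (a * b) * n + c))).mono' hc.aestronglyMeasurable
    (Filter.Eventually.of_forall fun x => ?_)
  have hg := gd_nonneg n a b c p x
  have hf := fabc_nonneg n a b c x
  rw [Real.norm_of_nonneg (by positivity)]
  have h1 : |x i| ^ q ≤ ∏ j, (1 + |x j|) ^ k := by
    calc |x i| ^ q ≤ (1 + |x i|) ^ q := by gcongr; linarith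
      _ ≤ (1 + |x i|) ^ (k : ℝ) := by
          apply Real.rpow_le_rpow_of_exponent_le _ hk
          linarith [abs_nonneg (x i)]
      _ = (1 + |x i|) ^ k := Real.rpow_natCast _ _
      _ ≤ _ := by
          rw [← Finset.mul_prod_erase _ _ (Finset.mem_univ i)]
          refine le_mul_of_one_le_right (by positivity) ?_
          refine (Finset.prod_const_one (s := Finset.univ.erase i) (M := ℝ)).symm.trans_le ?_
          exact Finset.prod_le_prod (fun _ _ => zero_le_one) fun j _ =>
            one_le_pow₀ (by linarith [abs_nonneg (x j)])
  simp only [gd, Finset.prod_mul_distrib, pow_add]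
  rw [mul_assoc]
  refine mul_le_mul h1 ?_ (by positivity) (by positivity)
  rw [← Finset.prod_mul_distrib]
  simp only [← pow_add]
  exact mul_le_mul (fabc_le n a b c ha x) (exp_sum_le n p hp x) (by positivity) (by positivity)

lemma int_gd (n a b c : ℕ) (ha : 1 ≤ a) (p : ℝ) (hp : 1 ≤ p) :
    Integrable (gd n a b c p) := by
  refine (int_dom n (2 * (a * b) * n + c)).mono'
    (gd_continuous n a b c p (by linarith)).aestronglyMeasurable
    (Filter.Eventually.of_forall fun x => ?_)
  rw [Real.norm_of_nonneg (gd_nonneg ..), Finset.prod_mul_distrib]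
  exact mul_le_mul (fabc_le n a b c ha x) (exp_sum_le n p hp x) (by positivity) (by positivity)

lemma fabc_symm (n a b c : ℕ) (σ : Equiv.Perm (Fin n)) (x : Fin n → ℝ) :
    fabc n a b c (fun i => x (σ i)) = fabc n a b c x := by
  have key : ∀ y : Fin n → ℝ,
      (∏ i : Fin n, ∏ j : Fin n, if i < j then |y i ^ a - y j ^ a| ^ b else 1) =
        Real.sqrt (∏ i : Fin n, ∏ j : Fin n, if i ≠ j then |y i ^ a - y j ^ a| ^ b else 1) := by
    intro y
    have h0 : 0 ≤ ∏ i : Fin n, ∏ j : Fin n, if i < j then |y i ^ a - y j ^ a| ^ b else 1 :=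
      Finset.prod_nonneg fun i _ => Finset.prod_nonneg fun j _ => by
        split_ifs <;> positivity
    rw [← Real.sqrt_mul_self h0]
    congr 1
    conv_lhs => rhs; rw [Finset.prod_comm]
    rw [← Finset.prod_mul_distrib]
    refine Finset.prod_congr rfl fun i _ => ?_
    rw [← Finset.prod_mul_distrib]
    refine Finset.prod_congr rfl fun j _ => ?_
    rcases lt_trichotomy i j with h | h | h
    · simp [h, h.ne, h.not_gt]
    · simp [h]
    · simp [h, h.ne', h.not_gt, abs_sub_comm]
  unfold fabc
  rw [key, key]
  congr 1
  · congr 1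
    rw [← Equiv.prod_comp σ (fun i => ∏ j : Fin n, if i ≠ j then |x i ^ a - x j ^ a| ^ b else 1)]
    refine Finset.prod_congr rfl fun i _ => ?_
    rw [← Equiv.prod_comp σ (fun j => if σ i ≠ j then |x (σ i) ^ a - x j ^ a| ^ b else 1)]
    refine Finset.prod_congr rfl fun j _ => ?_
    simp
  · exact Equiv.prod_comp σ (fun i => |x i| ^ c)

lemma gd_symm (n a b c : ℕ) (p : ℝ) (σ : Equiv.Perm (Fin n)) (x : Fin n → ℝ) :
    gd n a b c p (fun i => x (σ i)) = gd n a b c p x := by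
  unfold gd
  rw [fabc_symm, Equiv.sum_comp σ (fun i => |x i| ^ p)]

lemma integral_perm (n a b c : ℕ) (p : ℝ) (σ : Equiv.Perm (Fin n)) (h : (Fin n → ℝ) → ℝ) :
    ∫ x, h (fun i => x (σ i)) * gd n a b c p x = ∫ x, h x * gd n a b c p x := by
  have mp := volume_measurePreserving_piCongrLeft (fun _ : Fin n => ℝ) σ.symm
  rw [← mp.integral_comp' (g := fun x => h x * gd n a b c p x)]
  have e : ∀ x : Fin n → ℝ, (MeasurableEquiv.piCongrLeft (fun _ : Fin n => ℝ) σ.symm) x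
      = fun i => x (σ i) := by
    intro x
    ext i
    have := Equiv.piCongrLeft_apply_apply (fun _ : Fin n => ℝ) σ.symm x (σ i)
    rw [Equiv.symm_apply_apply] at this
    exact this
  simp only [e, gd_symm]

lemma phi_hasDerivAt (t : ℝ) (m : ℕ) (hm : Even m) (x : ℝ) :
    HasDerivAt (phi t m) (1 + (m + 1) * t * |x| ^ m) x := by
  have e : phi t m = fun x => x + t * x ^ (m + 1) := by
    ext x; simp only [phi, hm.pow_abs]; ring
  rw [e, hm.pow_abs]
  refine ((hasDerivAt_id x).add ((hasDerivAt_pow (m + 1) x).const_mul t)).congr_deriv ?_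
  simp; ring

lemma phi_strictMono (t : ℝ) (ht : 0 ≤ t) (m : ℕ) (hm : Even m) : StrictMono (phi t m) := by
  apply strictMono_of_deriv_pos
  intro x
  rw [(phi_hasDerivAt t m hm x).deriv]
  positivity

lemma abs_phi (t : ℝ) (ht : 0 ≤ t) (m : ℕ) (x : ℝ) : |phi t m x| = |x| * (1 + t * |x| ^ m) := by
  unfold phi
  rw [abs_mul, abs_of_nonneg (show 0 ≤ 1 + t * |x| ^ m by positivity)]

lemma phi_surj (t : ℝ) (ht : 0 ≤ t) (m : ℕ) : Function.Surjective (phi t m) := by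
  have hc : Continuous (phi t m) := by unfold phi; fun_prop
  apply hc.surjective
  · refine Filter.tendsto_atTop_mono' _ ?_ Filter.tendsto_id
    filter_upwards [Filter.eventually_ge_atTop 0] with x hx
    have : 0 ≤ x * (t * |x| ^ m) := by positivity
    simp only [phi, id]; linarith
  · refine Filter.tendsto_atBot_mono' _ ?_ Filter.tendsto_id
    filter_upwards [Filter.eventually_le_atBot 0] with x hx
    have : 0 ≤ t * |x| ^ m := by positivity
    simp only [phi, id]; nlinarith

/-- Jacobian factor -/
noncomputable def Jf (n : ℕ) (t : ℝ) (m : ℕ) (x : Fin n → ℝ) : ℝ :=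
  ∏ i, (1 + (m + 1) * t * |x i| ^ m)

lemma Jf_pos (n : ℕ) (t : ℝ) (ht : 0 ≤ t) (m : ℕ) (x : Fin n → ℝ) : 0 < Jf n t m x :=
  Finset.prod_pos fun i _ => by positivity

lemma change_var (n : ℕ) (t : ℝ) (ht : 0 ≤ t) (m : ℕ) (hm : Even m) (G : (Fin n → ℝ) → ℝ) :
    (Integrable G ↔ Integrable fun x => Jf n t m x * G (fun i => phi t m (x i))) ∧
    ∫ x, G x = ∫ x, Jf n t m x * G (fun i => phi t m (x i)) := by
  let F : (Fin n → ℝ) → (Fin n → ℝ) := fun x i => phi t m (x i)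
  let F' : (Fin n → ℝ) → ((Fin n → ℝ) →L[ℝ] (Fin n → ℝ)) := fun x =>
    ContinuousLinearMap.pi (fun i =>
      (ContinuousLinearMap.toSpanSingleton ℝ (1 + (m + 1) * t * |x i| ^ m) : ℝ →L[ℝ] ℝ).comp
        (ContinuousLinearMap.proj i))
  have hF : ∀ x ∈ (Set.univ : Set (Fin n → ℝ)), HasFDerivWithinAt F (F' x) Set.univ x := by
    intro x _
    rw [hasFDerivWithinAt_univ]
    refine hasFDerivAt_pi.2 fun i => ?_
    exact (phi_hasDerivAt t m hm (x i)).hasFDerivAt.comp x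
      (ContinuousLinearMap.proj (R := ℝ) (φ := fun _ : Fin n => ℝ) i).hasFDerivAt
  have hinj : Set.InjOn F Set.univ := by
    intro x _ y _ h
    ext i
    exact (phi_strictMono t ht m hm).injective (congrFun h i)
  have him : F '' Set.univ = Set.univ := by
    rw [Set.image_univ, Set.range_eq_univ]
    intro y
    choose x hx using fun i => phi_surj t ht m (y i)
    exact ⟨x, funext hx⟩
  have hdet : ∀ x, |(F' x).det| = Jf n t m x := by
    intro x
    have : (F' x).det = Jf n t m x := by
      simp only [F', ContinuousLinearMap.det_pi, Jf]
      refine Finset.prod_congr rfl fun i _ => ?_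
      simp
    rw [this, abs_of_pos (Jf_pos n t ht m x)]
  have h1 := integrableOn_image_iff_integrableOn_abs_det_fderiv_smul volume MeasurableSet.univ
    hF hinj G
  have h2 := integral_image_eq_integral_abs_det_fderiv_smul volume MeasurableSet.univ
    hF hinj G
  rw [him] at h1 h2
  simp only [integrableOn_univ, setIntegral_univ, hdet, smul_eq_mul] at h1 h2
  exact ⟨h1, h2⟩

/-- constant in the transport inequality -/
noncomputable def Kc (n a b c m : ℕ) : ℝ := (m + 1) + c + 2 * (a * b * (m + 1)) * n

lemma fabc_phi (n a b c m : ℕ) (ha : 1 ≤ a) (hm : 1 ≤ m) (t : ℝ) (ht : 0 ≤ t) (x : Fin n → ℝ) :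
    Jf n t m x * fabc n a b c (fun i => phi t m (x i)) ≤
      fabc n a b c x * Real.exp (Kc n a b c m * t * ∑ i, |x i| ^ m) := by
  have h1 : (∏ i : Fin n, ∏ j : Fin n,
      if i < j then |phi t m (x i) ^ a - phi t m (x j) ^ a| ^ b else 1) ≤
      (∏ i : Fin n, ∏ j : Fin n, if i < j then |x i ^ a - x j ^ a| ^ b else 1) *
        Real.exp (2 * (a * b * (m + 1)) * n * t * ∑ i, |x i| ^ m) := by
    have e : Real.exp (2 * (a * b * (m + 1)) * n * t * ∑ i, |x i| ^ m) =
        ∏ i : Fin n, ∏ j : Fin n, Real.exp (b * (a * (m + 1) * t * (|x i| ^ m + |x j| ^ m))) := by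
      simp only [← Real.exp_sum, ← Finset.mul_sum, Finset.sum_add_distrib, Finset.sum_const,
        Finset.card_univ, Fintype.card_fin, nsmul_eq_mul]
      congr 1; ring
    rw [e, ← Finset.prod_mul_distrib]
    refine Finset.prod_le_prod
      (fun i _ => Finset.prod_nonneg fun j _ => by split_ifs <;> positivity) fun i _ => ?_
    rw [← Finset.prod_mul_distrib]
    refine Finset.prod_le_prod (fun j _ => by split_ifs <;> positivity) fun j _ => ?_
    split_ifs
    · rw [Real.exp_nat_mul, ← mul_pow]
      exact pow_le_pow_left₀ (abs_nonneg _) (pair_bound a m ha hm t ht _ _) _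
    · rw [one_mul]
      exact Real.one_le_exp (by positivity)
  have h2 : ∏ i : Fin n, |phi t m (x i)| ^ c ≤
      (∏ i : Fin n, |x i| ^ c) * Real.exp (c * t * ∑ i, |x i| ^ m) := by
    rw [Finset.mul_sum, Real.exp_sum, ← Finset.prod_mul_distrib]
    refine Finset.prod_le_prod (fun i _ => by positivity) fun i _ => ?_
    rw [abs_phi t ht, mul_pow, mul_assoc]
    gcongr
    exact one_add_pow_le_exp _ (by positivity) _
  have h3 : Jf n t m x ≤ Real.exp ((m + 1) * t * ∑ i, |x i| ^ m) := by
    rw [Finset.mul_sum, Real.exp_sum]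
    refine Finset.prod_le_prod (fun i _ => by positivity) fun i _ => ?_
    rw [add_comm]
    exact Real.add_one_le_exp _
  unfold fabc
  have n1 : 0 ≤ ∏ i : Fin n, ∏ j : Fin n,
      if i < j then |phi t m (x i) ^ a - phi t m (x j) ^ a| ^ b else 1 :=
    Finset.prod_nonneg fun i _ => Finset.prod_nonneg fun j _ => by split_ifs <;> positivity
  have n2 : 0 ≤ ∏ i : Fin n, ∏ j : Fin n, if i < j then |x i ^ a - x j ^ a| ^ b else 1 :=
    Finset.prod_nonneg fun i _ => Finset.prod_nonneg fun j _ => by split_ifs <;> positivity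
  calc _ ≤ Real.exp ((m + 1) * t * ∑ i, |x i| ^ m) *
        (((∏ i : Fin n, ∏ j : Fin n, if i < j then |x i ^ a - x j ^ a| ^ b else 1) *
          Real.exp (2 * (a * b * (m + 1)) * n * t * ∑ i, |x i| ^ m)) *
        ((∏ i : Fin n, |x i| ^ c) * Real.exp (c * t * ∑ i, |x i| ^ m))) := by
        gcongr
    _ = (∏ i : Fin n, ∏ j : Fin n, if i < j then |x i ^ a - x j ^ a| ^ b else 1) *
          (∏ i : Fin n, |x i| ^ c) * (Real.exp ((m + 1) * t * ∑ i, |x i| ^ m) *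
          Real.exp (2 * (a * b * (m + 1)) * n * t * ∑ i, |x i| ^ m) *
          Real.exp (c * t * ∑ i, |x i| ^ m)) := by ring
    _ = _ := by
        rw [← Real.exp_add, ← Real.exp_add]
        congr 2
        unfold Kc; ring

lemma rpow_phi (t : ℝ) (ht : 0 ≤ t) (m : ℕ) (p : ℝ) (hp : 1 ≤ p) (x : ℝ) :
    p * t * (|phi t m x| / (1 + t * |phi t m x| ^ m)) ^ (p + m) ≤ |phi t m x| ^ p - |x| ^ p := by
  have h0 := abs_nonneg x
  have hs : 0 ≤ t * |x| ^ m := by positivity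
  have h1 : |x| ≤ |phi t m x| := by
    rw [abs_phi t ht]; exact le_mul_of_one_le_right h0 (by linarith)
  have h2 : |phi t m x| / (1 + t * |phi t m x| ^ m) ≤ |x| := by
    rw [div_le_iff₀ (by positivity)]
    conv_lhs => rw [abs_phi t ht]
    gcongr
  have h3 : (|phi t m x| / (1 + t * |phi t m x| ^ m)) ^ (p + m) ≤ |x| ^ (p + m) := by
    gcongr
  have h4 : |x| ^ (p + m) = |x| ^ p * |x| ^ m := by
    rw [Real.rpow_add_of_nonneg h0 (by linarith) (by positivity), Real.rpow_natCast]
  have h5 : |phi t m x| ^ p = |x| ^ p * (1 + t * |x| ^ m) ^ p := by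
    rw [abs_phi t ht, Real.mul_rpow h0 (by positivity)]
  have h6 := one_add_mul_self_le_rpow_one_add (s := t * |x| ^ m) (by linarith) hp
  have h7 := mul_le_mul_of_nonneg_left h6 (Real.rpow_nonneg h0 p)
  have h8 := mul_le_mul_of_nonneg_left h3 (show 0 ≤ p * t by positivity)
  rw [h4] at h8
  rw [h5]
  linarith

lemma transport_pt (n a b c m : ℕ) (ha : 1 ≤ a) (hm : 1 ≤ m) (t : ℝ) (ht : 0 ≤ t)
    (p : ℝ) (hp : 1 ≤ p) (x : Fin n → ℝ) :
    (Jf n t m x * gd n a b c p (fun i => phi t m (x i))) *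
      (p * t * ∑ i, (|phi t m (x i)| / (1 + t * |phi t m (x i)| ^ m)) ^ (p + m)) ≤
    (Jf n t m x * gd n a b c p (fun i => phi t m (x i))) *
      (Kc n a b c m * t * ∑ i, |phi t m (x i)| ^ m) + gd n a b c p x
      - Jf n t m x * gd n a b c p (fun i => phi t m (x i)) := by
  set P := Jf n t m x * gd n a b c p (fun i => phi t m (x i)) with hP
  have hP0 : 0 ≤ P := mul_nonneg (Jf_pos n t ht m x).le (gd_nonneg ..)
  set v := Kc n a b c m * t * ∑ i, |x i| ^ m - ∑ i, (|phi t m (x i)| ^ p - |x i| ^ p) with hv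
  have h1 : P ≤ gd n a b c p x * Real.exp v := by
    have := fabc_phi n a b c m ha hm t ht x
    calc P = (Jf n t m x * fabc n a b c (fun i => phi t m (x i))) *
          Real.exp (-∑ i, |phi t m (x i)| ^ p) := by simp only [hP, gd]; ring
      _ ≤ (fabc n a b c x * Real.exp (Kc n a b c m * t * ∑ i, |x i| ^ m)) *
          Real.exp (-∑ i, |phi t m (x i)| ^ p) := by gcongr
      _ = _ := by
          simp only [gd]
          rw [mul_assoc (fabc n a b c x), mul_assoc (fabc n a b c x), ← Real.exp_add,
            ← Real.exp_add, hv, Finset.sum_sub_distrib]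
          congr 2; ring
  have h2 : P * (1 - v) ≤ gd n a b c p x := by
    calc P * (1 - v) ≤ P * Real.exp (-v) := by
          gcongr; linarith [Real.add_one_le_exp (-v)]
      _ ≤ gd n a b c p x * Real.exp v * Real.exp (-v) := by gcongr
      _ = _ := by rw [mul_assoc, ← Real.exp_add]; simp
  have h3 : p * t * ∑ i, (|phi t m (x i)| / (1 + t * |phi t m (x i)| ^ m)) ^ (p + m) ≤
      ∑ i, (|phi t m (x i)| ^ p - |x i| ^ p) := by
    rw [Finset.mul_sum]
    exact Finset.sum_le_sum fun i _ => rpow_phi t ht m p hp (x i)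
  have hK : 0 ≤ Kc n a b c m := by unfold Kc; positivity
  have h4 : Kc n a b c m * t * ∑ i, |x i| ^ m ≤
      Kc n a b c m * t * ∑ i, |phi t m (x i)| ^ m := by
    refine mul_le_mul_of_nonneg_left (Finset.sum_le_sum fun i _ => ?_) (by positivity)
    refine pow_le_pow_left₀ (abs_nonneg _) ?_ _
    have hs : 0 ≤ t * |x i| ^ m := by positivity
    rw [abs_phi t ht]; exact le_mul_of_one_le_right (abs_nonneg _) (by linarith)
  have h5 := mul_le_mul_of_nonneg_left h3 hP0
  have h6 := mul_le_mul_of_nonneg_left h4 hP0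
  have h7 : P * (1 - v) = P - P * (Kc n a b c m * t * ∑ i, |x i| ^ m)
    + P * ∑ i, (|phi t m (x i)| ^ p - |x i| ^ p) := by rw [hv]; ring
  linarith

lemma int_npow (n a b c : ℕ) (ha : 1 ≤ a) (p : ℝ) (hp : 1 ≤ p) (i : Fin n) (m : ℕ) :
    Integrable (fun x : Fin n → ℝ => |x i| ^ m * gd n a b c p x) := by
  have := int_moment n a b c ha p hp i m (by positivity)
  simpa only [Real.rpow_natCast] using this

lemma trunc_le (t : ℝ) (ht : 0 ≤ t) (m : ℕ) (x : ℝ) (q : ℝ) (hq : 0 ≤ q) :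
    (|x| / (1 + t * |x| ^ m)) ^ q ≤ |x| ^ q := by
  have hs : 0 ≤ t * |x| ^ m := by positivity
  have := div_le_self (abs_nonneg x) (show 1 ≤ 1 + t * |x| ^ m by linarith)
  gcongr

lemma trunc_cont (n : ℕ) (i : Fin n) (t : ℝ) (ht : 0 ≤ t) (m : ℕ) (q : ℝ) (hq : 0 ≤ q) :
    Continuous fun x : Fin n → ℝ => (|x i| / (1 + t * |x i| ^ m)) ^ q := by
  refine Continuous.rpow_const ?_ fun _ => Or.inr hq
  refine Continuous.div (by fun_prop) (by fun_prop) fun x => ?_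
  positivity

lemma int_trunc (n a b c : ℕ) (ha : 1 ≤ a) (p : ℝ) (hp : 1 ≤ p) (i : Fin n) (m : ℕ)
    (t : ℝ) (ht : 0 ≤ t) (q : ℝ) (hq : 0 ≤ q) :
    Integrable (fun x : Fin n → ℝ => (|x i| / (1 + t * |x i| ^ m)) ^ q * gd n a b c p x) := by
  refine (int_moment n a b c ha p hp i q hq).mono'
    ((trunc_cont n i t ht m q hq).mul (gd_continuous n a b c p (by linarith))).aestronglyMeasurable
    (Filter.Eventually.of_forall fun x => ?_)
  have hg := gd_nonneg n a b c p x
  rw [Real.norm_of_nonneg (by positivity)]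
  have := trunc_le t ht m (x i) q hq
  gcongr

lemma transport_int (n a b c m : ℕ) (ha : 1 ≤ a) (hm : 1 ≤ m) (hme : Even m) (t : ℝ) (ht : 0 < t)
    (p : ℝ) (hp : 1 ≤ p) :
    p * ∑ i, ∫ x : Fin n → ℝ, (|x i| / (1 + t * |x i| ^ m)) ^ (p + m) * gd n a b c p x ≤
      Kc n a b c m * ∑ i, ∫ x : Fin n → ℝ, |x i| ^ m * gd n a b c p x := by
  have hpm : 0 ≤ p + m := by positivity
  let G1 : (Fin n → ℝ) → ℝ := fun x =>
    gd n a b c p x * (p * t * ∑ i, (|x i| / (1 + t * |x i| ^ m)) ^ (p + m))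
  let G2 : (Fin n → ℝ) → ℝ := fun x =>
    gd n a b c p x * (Kc n a b c m * t * ∑ i, |x i| ^ m)
  have e1 : G1 = fun x => p * t *
      ∑ i, ((|x i| / (1 + t * |x i| ^ m)) ^ (p + m) * gd n a b c p x) := by
    ext x; simp only [G1, ← Finset.sum_mul]; ring
  have e2 : G2 = fun x => Kc n a b c m * t * ∑ i, (|x i| ^ m * gd n a b c p x) := by
    ext x; simp only [G2, ← Finset.sum_mul]; ring
  have i1 : Integrable G1 := by
    rw [e1]
    exact (integrable_finsetSum _ fun i _ =>
      int_trunc n a b c ha p hp i m t ht.le (p + m) hpm).const_mul _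
  have i2 : Integrable G2 := by
    rw [e2]
    exact (integrable_finsetSum _ fun i _ => int_npow n a b c ha p hp i m).const_mul _
  have i3 := int_gd n a b c ha p hp
  obtain ⟨c1, d1⟩ := change_var n t ht.le m hme G1
  obtain ⟨c2, d2⟩ := change_var n t ht.le m hme G2
  obtain ⟨c3, d3⟩ := change_var n t ht.le m hme (gd n a b c p)
  have key : ∫ x, Jf n t m x * G1 (fun i => phi t m (x i)) ≤
      ∫ x, (Jf n t m x * G2 (fun i => phi t m (x i)) + gd n a b c p x
        - Jf n t m x * gd n a b c p (fun i => phi t m (x i))) := by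
    refine integral_mono (c1.1 i1) (((c2.1 i2).add i3).sub (c3.1 i3)) fun x => ?_
    have := transport_pt n a b c m ha hm t ht.le p hp x
    simp only [G1, G2]
    linarith
  have k1 := integral_sub ((c2.1 i2).add i3) (c3.1 i3)
  have k2 := integral_add (c2.1 i2) i3
  simp only [Pi.add_apply] at k1
  rw [k1, k2, ← d1, ← d2, ← d3] at key
  have f1 : ∫ x, G1 x = t * (p * ∑ i, ∫ x : Fin n → ℝ,
      (|x i| / (1 + t * |x i| ^ m)) ^ (p + m) * gd n a b c p x) := by
    rw [e1, integral_const_mul, integral_finsetSum _ fun i _ =>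
      int_trunc n a b c ha p hp i m t ht.le (p + m) hpm]
    ring
  have f2 : ∫ x, G2 x = t * (Kc n a b c m * ∑ i, ∫ x : Fin n → ℝ,
      |x i| ^ m * gd n a b c p x) := by
    rw [e2, integral_const_mul, integral_finsetSum _ fun i _ =>
      int_npow n a b c ha p hp i m]
    ring
  rw [f1, f2] at key
  exact le_of_mul_le_mul_left (by linarith) ht

lemma transport_lim (n a b c m : ℕ) (ha : 1 ≤ a) (hm : 1 ≤ m) (hme : Even m)
    (p : ℝ) (hp : 1 ≤ p) :
    p * ∑ i, ∫ x : Fin n → ℝ, |x i| ^ (p + m) * gd n a b c p x ≤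
      Kc n a b c m * ∑ i, ∫ x : Fin n → ℝ, |x i| ^ m * gd n a b c p x := by
  have hpm : 0 ≤ p + m := by positivity
  have hlim : Filter.Tendsto (fun t : ℝ => p * ∑ i, ∫ x : Fin n → ℝ,
      (|x i| / (1 + t * |x i| ^ m)) ^ (p + m) * gd n a b c p x) (nhdsWithin 0 (Set.Ioi 0))
      (nhds (p * ∑ i, ∫ x : Fin n → ℝ, |x i| ^ (p + m) * gd n a b c p x)) := by
    refine Filter.Tendsto.const_mul _ (tendsto_finsetSum _ fun i _ => ?_)
    refine tendsto_integral_filter_of_dominated_convergence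
      (fun x => |x i| ^ (p + m) * gd n a b c p x) ?_ ?_
      (int_moment n a b c ha p hp i (p + m) hpm) ?_
    · filter_upwards [self_mem_nhdsWithin] with t ht
      exact (int_trunc n a b c ha p hp i m t (le_of_lt ht) (p + m) hpm).aestronglyMeasurable
    · filter_upwards [self_mem_nhdsWithin] with t ht
      refine Filter.Eventually.of_forall fun x => ?_
      have ht' : 0 < t := ht
      have hg := gd_nonneg n a b c p x
      rw [Real.norm_of_nonneg (by positivity)]
      have := trunc_le t ht'.le m (x i) (p + m) hpm
      gcongr
    · refine Filter.Eventually.of_forall fun x => ?_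
      refine Filter.Tendsto.mul_const _ ?_
      refine Filter.Tendsto.rpow_const ?_ (Or.inr hpm)
      have : ContinuousAt (fun t : ℝ => |x i| / (1 + t * |x i| ^ m)) 0 := by
        refine ContinuousAt.div (by fun_prop) (by fun_prop) (by simp)
      have h2 := this.tendsto
      simp only [zero_mul, add_zero, div_one] at h2
      exact h2.mono_left nhdsWithin_le_nhds
  refine le_of_tendsto hlim ?_
  filter_upwards [self_mem_nhdsWithin] with t ht
  exact transport_int n a b c m ha hm hme t ht p hp

lemma fabc_scale (n a b c : ℕ) (ha : 1 ≤ a) (hb : 1 ≤ b) (L : ℝ) (hL : 0 ≤ L) (x : Fin n → ℝ) :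
    fabc n a b c x * Real.exp (∑ i : Fin n, ∑ j : Fin n, if i < j then L else 0) ≤
      fabc n a b c (Real.exp L • x) := by
  have hl : 1 ≤ Real.exp L := Real.one_le_exp hL
  unfold fabc
  have h1 : (∏ i : Fin n, ∏ j : Fin n, if i < j then |x i ^ a - x j ^ a| ^ b else 1) *
      Real.exp (∑ i : Fin n, ∑ j : Fin n, if i < j then L else 0) ≤
      ∏ i : Fin n, ∏ j : Fin n,
        if i < j then |(Real.exp L • x) i ^ a - (Real.exp L • x) j ^ a| ^ b else 1 := by
    simp only [Real.exp_sum]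
    rw [← Finset.prod_mul_distrib]
    refine Finset.prod_le_prod
      (fun i _ => by
        rw [← Finset.prod_mul_distrib]
        exact Finset.prod_nonneg fun j _ => by split_ifs <;> positivity) fun i _ => ?_
    rw [← Finset.prod_mul_distrib]
    refine Finset.prod_le_prod (fun j _ => by split_ifs <;> positivity) fun j _ => ?_
    split_ifs
    · simp only [Pi.smul_apply, smul_eq_mul, mul_pow]
      rw [← mul_sub, abs_mul, mul_pow,
        abs_of_nonneg (show 0 ≤ Real.exp L ^ a by positivity), ← pow_mul, mul_comm]
      gcongr
      exact le_self_pow₀ hl (by positivity)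
    · simp
  have h2 : ∏ i : Fin n, |x i| ^ c ≤ ∏ i : Fin n, |(Real.exp L • x) i| ^ c := by
    refine Finset.prod_le_prod (fun i _ => by positivity) fun i _ => ?_
    simp only [Pi.smul_apply, smul_eq_mul, abs_mul, abs_of_pos (Real.exp_pos L)]
    gcongr
    exact le_mul_of_one_le_left (abs_nonneg _) hl
  calc _ = ((∏ i : Fin n, ∏ j : Fin n, if i < j then |x i ^ a - x j ^ a| ^ b else 1) *
      Real.exp (∑ i : Fin n, ∑ j : Fin n, if i < j then L else 0)) * ∏ i : Fin n, |x i| ^ c := by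
        ring
    _ ≤ _ := mul_le_mul h1 h2 (by positivity)
        (Finset.prod_nonneg fun i _ => Finset.prod_nonneg fun j _ => by split_ifs <;> positivity)

lemma sum_pairs (n : ℕ) (L : ℝ) :
    2 * (∑ i : Fin n, ∑ j : Fin n, if i < j then L else 0) + n * L = n ^ 2 * L := by
  have h : (∑ i : Fin n, ∑ j : Fin n, if i < j then L else 0) +
      (∑ i : Fin n, ∑ j : Fin n, if j < i then L else 0) +
      (∑ i : Fin n, ∑ j : Fin n, if i = j then L else 0) = ∑ i : Fin n, ∑ j : Fin n, L := by
    simp only [← Finset.sum_add_distrib]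
    refine Finset.sum_congr rfl fun i _ => Finset.sum_congr rfl fun j _ => ?_
    rcases lt_trichotomy i j with h | h | h
    · simp [h, h.ne, h.not_gt]
    · simp [h]
    · simp [h, h.ne', h.not_gt]
  have h2 : (∑ i : Fin n, ∑ j : Fin n, if j < i then L else 0) =
    ∑ i : Fin n, ∑ j : Fin n, if i < j then L else 0 := Finset.sum_comm
  rw [h2] at h
  simp at h
  linarith

lemma moment_p (n a b c : ℕ) (ha : 1 ≤ a) (hb : 1 ≤ b) (p : ℝ) (hp : 1 ≤ p) :
    (n : ℝ) ^ 2 / (4 * p) * (∫ x, gd n a b c p x) ≤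
      ∑ i, ∫ x : Fin n → ℝ, |x i| ^ p * gd n a b c p x := by
  have hp0 : 0 < p := by linarith
  set L := Real.log 2 / p with hL
  have hL0 : 0 ≤ L := by have := Real.log_pos (show (1 : ℝ) < 2 by norm_num); positivity
  set S := ∑ i : Fin n, ∑ j : Fin n, if i < j then L else 0 with hS
  have hsp := sum_pairs n L
  rw [← hS] at hsp
  have i3 := int_gd n a b c ha p hp
  have hexp : Real.exp L ^ p = 2 := by
    rw [← Real.exp_mul, hL, div_mul_cancel₀ _ hp0.ne', Real.exp_log (by norm_num)]
  have hpt : ∀ x : Fin n → ℝ,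
      gd n a b c p x * (1 + (S + n * L)) - ∑ i, |x i| ^ p * gd n a b c p x ≤
        Real.exp L ^ n * gd n a b c p (Real.exp L • x) := by
    intro x
    have h1 := fabc_scale n a b c ha hb L hL0 x
    rw [← hS] at h1
    have h2 : ∑ i, |(Real.exp L • x) i| ^ p = 2 * ∑ i, |x i| ^ p := by
      rw [Finset.mul_sum]
      refine Finset.sum_congr rfl fun i _ => ?_
      simp only [Pi.smul_apply, smul_eq_mul, abs_mul, abs_of_pos (Real.exp_pos L)]
      rw [Real.mul_rpow (Real.exp_pos L).le (abs_nonneg _), hexp]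
    have h3 : gd n a b c p x * Real.exp (S + n * L - ∑ i, |x i| ^ p) ≤
        Real.exp L ^ n * gd n a b c p (Real.exp L • x) := by
      calc _ = Real.exp L ^ n * ((fabc n a b c x * Real.exp S) *
            Real.exp (-(2 * ∑ i, |x i| ^ p))) := by
            rw [← Real.exp_nat_mul]
            simp only [gd]
            have : Real.exp (-∑ i, |x i| ^ p) * Real.exp (S + n * L - ∑ i, |x i| ^ p) =
              Real.exp (n * L) * Real.exp S * Real.exp (-(2 * ∑ i, |x i| ^ p)) := by
              rw [← Real.exp_add, ← Real.exp_add, ← Real.exp_add]; congr 1; ring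
            rw [mul_assoc, this]; ring
        _ ≤ _ := by
            rw [gd, h2]; gcongr
    have h4 := mul_le_mul_of_nonneg_left (Real.add_one_le_exp (S + n * L - ∑ i, |x i| ^ p))
      (gd_nonneg n a b c p x)
    rw [← Finset.sum_mul]
    linarith
  have hsumInt : Integrable fun x : Fin n → ℝ => ∑ i, |x i| ^ p * gd n a b c p x :=
    integrable_finsetSum _ fun i _ => int_moment n a b c ha p hp i p hp0.le
  have hmono := integral_mono ((i3.mul_const (1 + (S + n * L))).sub hsumInt)
    ((i3.comp_smul (Real.exp_pos L).ne').const_mul (Real.exp L ^ n)) hpt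
  rw [integral_const_mul, Measure.integral_comp_smul] at hmono
  have k1 := integral_sub (i3.mul_const (1 + (S + n * L))) hsumInt
  simp only [Pi.sub_apply] at hmono
  rw [k1, integral_mul_const, integral_finsetSum _ fun i _ =>
    int_moment n a b c ha p hp i p hp0.le, Module.finrank_fin_fun,
    abs_of_pos (by positivity), smul_eq_mul, mul_inv_cancel_left₀ (by positivity)] at hmono
  have hZ : 0 ≤ ∫ x, gd n a b c p x := integral_nonneg fun x => gd_nonneg ..
  have hl2 : 1 / 2 ≤ Real.log 2 := by linarith [Real.log_two_gt_d9]
  have hc : (n : ℝ) ^ 2 / (4 * p) ≤ S + n * L := by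
    have : (n : ℝ) ^ 2 / (4 * p) ≤ n ^ 2 * L / 2 := by
      rw [hL]
      have : (n : ℝ) ^ 2 * (Real.log 2 / p) / 2 = n ^ 2 / (4 * p) * (2 * Real.log 2) := by
        field_simp; ring
      rw [this]
      exact le_mul_of_one_le_right (by positivity) (by linarith)
    have : 0 ≤ n * L := by positivity
    linarith
  have := mul_le_mul_of_nonneg_right hc hZ
  linarith

lemma sum_moment (n a b c : ℕ) (p : ℝ) (i0 : Fin n) (u : ℝ → ℝ) :
    ∑ i, ∫ x : Fin n → ℝ, u (x i) * gd n a b c p x =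
      n * ∫ x : Fin n → ℝ, u (x i0) * gd n a b c p x := by
  rw [Finset.sum_congr rfl (g := fun _ => ∫ x : Fin n → ℝ, u (x i0) * gd n a b c p x)]
  · simp
  · intro i _
    rw [← integral_perm n a b c p (Equiv.swap i0 i) (fun x => u (x i0))]
    simp

lemma sum_moment2 (n a b c : ℕ) (p : ℝ) (i0 i1 : Fin n) (h01 : i0 ≠ i1) (i j : Fin n)
    (hij : i ≠ j) :
    ∫ x : Fin n → ℝ, x i ^ 2 * x j ^ 2 * gd n a b c p x =
      ∫ x : Fin n → ℝ, x i0 ^ 2 * x i1 ^ 2 * gd n a b c p x := by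
  obtain ⟨σ, h0, h1⟩ : ∃ σ : Equiv.Perm (Fin n), σ i0 = i ∧ σ i1 = j := by
    refine ⟨(Equiv.swap i0 i).trans (Equiv.swap (Equiv.swap i0 i i1) j), ?_, ?_⟩
    · simp only [Equiv.trans_apply, Equiv.swap_apply_left]
      apply Equiv.swap_apply_of_ne_of_ne _ hij
      intro h
      have := (Equiv.swap i0 i).injective (h.symm.trans (Equiv.swap_apply_left i0 i).symm)
      exact h01 this.symm
    · simp
  rw [← integral_perm n a b c p σ (fun x => x i0 ^ 2 * x i1 ^ 2)]
  simp only [h0, h1]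

/-- The Jensen inequality, via Bernoulli. -/
lemma jensen {α : Type*} [MeasurableSpace α] (μ : Measure α) (u g : α → ℝ) (s : ℝ) (hs : 1 ≤ s)
    (hu : ∀ x, 0 ≤ u x) (hg : ∀ x, 0 ≤ g x) (h0 : Integrable g μ)
    (h1 : Integrable (fun x => u x * g x) μ) (h2 : Integrable (fun x => u x ^ s * g x) μ)
    (hZ : 0 < ∫ x, g x ∂μ) :
    ((∫ x, u x * g x ∂μ) / ∫ x, g x ∂μ) ^ s ≤ (∫ x, u x ^ s * g x ∂μ) / ∫ x, g x ∂μ := by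
  set Z := ∫ x, g x ∂μ
  set M := (∫ x, u x * g x ∂μ) / Z with hM
  have hM0 : 0 ≤ M := div_nonneg (integral_nonneg fun x => mul_nonneg (hu x) (hg x)) hZ.le
  rcases hM0.eq_or_lt with h | h
  · rw [← h, Real.zero_rpow (by linarith)]
    exact div_nonneg (integral_nonneg fun x =>
      mul_nonneg (Real.rpow_nonneg (hu x) _) (hg x)) hZ.le
  have hMs : 0 < M ^ s := Real.rpow_pos_of_pos h s
  have hpt : ∀ x, M ^ s * (1 - s) * g x + M ^ s * s / M * (u x * g x) ≤ u x ^ s * g x := by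
    intro x
    have hb := one_add_mul_self_le_rpow_one_add (s := u x / M - 1)
      (by have := div_nonneg (hu x) h.le; linarith) hs
    rw [add_sub_cancel, Real.div_rpow (hu x) h.le, le_div_iff₀ hMs] at hb
    have := mul_le_mul_of_nonneg_right hb (hg x)
    refine le_trans (le_of_eq ?_) this
    field_simp
    ring
  have := integral_mono ((h0.const_mul _).add (h1.const_mul _)) h2 hpt
  have k := integral_add (h0.const_mul (M ^ s * (1 - s))) (h1.const_mul (M ^ s * s / M))
  simp only [Pi.add_apply] at this
  rw [k, integral_const_mul, integral_const_mul] at this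
  have e : ∫ x, u x * g x ∂μ = M * Z := by rw [hM]; field_simp
  rw [e] at this
  rw [le_div_iff₀ hZ]
  refine le_trans (le_of_eq ?_) this
  have : M ^ s * s / M * (M * Z) = M ^ s * s * Z := by field_simp
  rw [this]; ring

lemma moment_eq (n a b c : ℕ) (p : ℝ) (i0 i : Fin n) (u : ℝ → ℝ) :
    ∫ x : Fin n → ℝ, u (x i) * gd n a b c p x = ∫ x : Fin n → ℝ, u (x i0) * gd n a b c p x := by
  rw [← integral_perm n a b c p (Equiv.swap i0 i) (fun x => u (x i0))]
  simp

lemma int_cross (n a b c : ℕ) (ha : 1 ≤ a) (p : ℝ) (hp : 1 ≤ p) (i j : Fin n) :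
    Integrable (fun x : Fin n → ℝ => x i ^ 2 * x j ^ 2 * gd n a b c p x) := by
  have hgc := gd_continuous n a b c p (by linarith)
  have hc : Continuous (fun x : Fin n → ℝ => x i ^ 2 * x j ^ 2 * gd n a b c p x) := by fun_prop
  refine ((int_npow n a b c ha p hp i 4).add (int_npow n a b c ha p hp j 4)).mono'
    hc.aestronglyMeasurable (Filter.Eventually.of_forall fun x => ?_)
  have hg := gd_nonneg n a b c p x
  rw [Real.norm_of_nonneg (by positivity), Pi.add_apply, ← add_mul]
  gcongr
  rw [(show Even 4 by decide).pow_abs, (show Even 4 by decide).pow_abs]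
  nlinarith [sq_nonneg (x i ^ 2 - x j ^ 2), sq_nonneg (x i ^ 2 + x j ^ 2)]

/-- a point where the density is positive -/
noncomputable def pt (n : ℕ) : Fin n → ℝ := fun i => ((i : ℝ) + 1) / (n + 1)

lemma pt_pos (n : ℕ) (i : Fin n) : 0 < pt n i := by unfold pt; positivity

lemma pt_lt (n : ℕ) (i : Fin n) : pt n i < 1 := by
  unfold pt
  rw [div_lt_one (by positivity)]
  have : (i : ℝ) < n := by exact_mod_cast i.2
  linarith

lemma fabc_pt (n a b c : ℕ) (ha : 1 ≤ a) : 0 < fabc n a b c (pt n) := by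
  unfold fabc
  refine mul_pos (Finset.prod_pos fun i _ => Finset.prod_pos fun j _ => ?_)
    (Finset.prod_pos fun i _ => ?_)
  · split_ifs with h
    · refine pow_pos (abs_pos.2 (sub_ne_zero.2 (ne_of_lt ?_))) _
      refine pow_lt_pow_left₀ ?_ (pt_pos n i).le (by omega)
      unfold pt
      have : (i : ℝ) < j := by exact_mod_cast h
      gcongr
    · exact one_pos
  · exact pow_pos (abs_pos.2 (pt_pos n i).ne') _

lemma Z_pos (n a b c : ℕ) (ha : 1 ≤ a) (p : ℝ) (hp : 1 ≤ p) : 0 < ∫ x, gd n a b c p x :=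
  integral_pos_of_integrable_nonneg_nonzero (x := pt n) (gd_continuous n a b c p (by linarith))
    (int_gd n a b c ha p hp) (fun x => gd_nonneg ..)
    (mul_pos (fabc_pt n a b c ha) (Real.exp_pos _)).ne'

lemma small_n (n a b c : ℕ) (ha : 1 ≤ a) (i0 i1 : Fin n) :
    ∃ δ : ℝ, 0 < δ ∧ ∀ p : ℝ, 1 ≤ p → δ * (∫ x, gd n a b c p x) ≤
      ∫ x, x i0 ^ 2 * x i1 ^ 2 * gd n a b c p x := by
  let H : (Fin n → ℝ) → ℝ := fun x =>
    x i0 ^ 2 * x i1 ^ 2 * (fabc n a b c x * ∏ i, max 0 (1 - |x i|))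
  have hfc := fabc_continuous n a b c
  have hHc : Continuous H := by
    refine Continuous.mul (by fun_prop) (hfc.mul ?_)
    exact continuous_finsetProd _ fun i _ => by fun_prop
  have hH0 : ∀ x, 0 ≤ H x := fun x => by
    have := fabc_nonneg n a b c x
    have h2 : 0 ≤ ∏ i, max 0 (1 - |x i|) := Finset.prod_nonneg fun i _ => le_max_left _ _
    simp only [H]; positivity
  have hle : ∀ p : ℝ, 1 ≤ p → ∀ x, H x ≤
      Real.exp n * (x i0 ^ 2 * x i1 ^ 2 * gd n a b c p x) := by
    intro p hp x
    have hf := fabc_nonneg n a b c x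
    have h1 : ∏ i, max 0 (1 - |x i|) ≤ Real.exp n * Real.exp (-∑ i, |x i| ^ p) := by
      have e : Real.exp n * Real.exp (-∑ i, |x i| ^ p) = ∏ i : Fin n, Real.exp (1 - |x i| ^ p) := by
        rw [← Real.exp_add, ← Real.exp_sum]; congr 1; simp; ring
      rw [e]
      refine Finset.prod_le_prod (fun i _ => le_max_left _ _) fun i _ => ?_
      refine max_le (Real.exp_pos _).le ?_
      rcases le_total |x i| 1 with h | h
      · have h3 : |x i| ^ p ≤ 1 := Real.rpow_le_one (abs_nonneg _) h (by linarith)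
        have h4 : 1 ≤ Real.exp (1 - |x i| ^ p) := Real.one_le_exp (by linarith)
        linarith [abs_nonneg (x i)]
      · linarith [Real.exp_pos (1 - |x i| ^ p)]
    simp only [H, gd]
    calc _ ≤ x i0 ^ 2 * x i1 ^ 2 * (fabc n a b c x *
          (Real.exp n * Real.exp (-∑ i, |x i| ^ p))) := by gcongr
      _ = _ := by ring
  have hHi : Integrable H := by
    refine ((int_cross n a b c ha 1 le_rfl i0 i1).const_mul (Real.exp n)).mono'
      hHc.aestronglyMeasurable (Filter.Eventually.of_forall fun x => ?_)
    rw [Real.norm_of_nonneg (hH0 x)]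
    exact hle 1 le_rfl x
  have hHpos : 0 < ∫ x, H x := by
    refine integral_pos_of_integrable_nonneg_nonzero (x := pt n) hHc hHi hH0 (ne_of_gt ?_)
    have h0 := pt_pos n i0
    have h1 := pt_pos n i1
    have h2 := fabc_pt n a b c ha
    have h3 : 0 < ∏ i, max 0 (1 - |pt n i|) := Finset.prod_pos fun i _ => by
      rw [lt_max_iff, abs_of_pos (pt_pos n i)]
      right; linarith [pt_lt n i]
    simp only [H]; positivity
  set W := ∫ x : Fin n → ℝ, ∏ i, ((1 + |x i|) ^ (2 * (a * b) * n + c) * Real.exp (1 - |x i|))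
    with hW
  have hW0 : 0 ≤ W := integral_nonneg fun x => Finset.prod_nonneg fun i _ => by positivity
  refine ⟨(∫ x, H x) / (Real.exp n * (W + 1)), by positivity, fun p hp => ?_⟩
  have hZ : ∫ x, gd n a b c p x ≤ W := by
    refine integral_mono (int_gd n a b c ha p hp) (int_dom n _) fun x => ?_
    simp only [Finset.prod_mul_distrib]
    exact mul_le_mul (fabc_le n a b c ha x) (exp_sum_le n p hp x) (by positivity) (by positivity)
  have hB := integral_mono hHi ((int_cross n a b c ha p hp i0 i1).const_mul (Real.exp n))
    (hle p hp)
  rw [integral_const_mul] at hB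
  rw [div_mul_eq_mul_div, div_le_iff₀ (by positivity)]
  have hB0 : 0 ≤ ∫ x, x i0 ^ 2 * x i1 ^ 2 * gd n a b c p x := integral_nonneg fun x => by
    have := gd_nonneg n a b c p x
    positivity
  calc _ ≤ (∫ x, H x) * (W + 1) := by gcongr; linarith
    _ ≤ (Real.exp n * ∫ x, x i0 ^ 2 * x i1 ^ 2 * gd n a b c p x) * (W + 1) := by gcongr
    _ = _ := by ring

lemma real1 (α C n p : ℝ) (hα : 0 ≤ α) (hC : 1 ≤ C) (hn : 1 ≤ n) (hp : 1 ≤ p)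
    (h : p * α ^ ((p + 4) / 4) ≤ C * n * α) : α ≤ C ^ 4 * n ^ (4 / p) := by
  rcases hα.eq_or_lt with h0 | h0
  · rw [← h0]; positivity
  have e : α ^ ((p + 4) / 4) = α ^ (p / 4) * α := by
    rw [show (p + 4) / 4 = p / 4 + 1 by ring, Real.rpow_add_one h0.ne']
  rw [e, ← mul_assoc] at h
  have h1 := le_of_mul_le_mul_right h h0
  have h2 : α ^ (p / 4) ≤ C * n := le_trans (le_mul_of_one_le_left (by positivity) hp) h1
  have h3 : α = (α ^ (p / 4)) ^ (4 / p) := by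
    rw [← Real.rpow_mul hα, show p / 4 * (4 / p) = 1 by field_simp, Real.rpow_one]
  calc α = (α ^ (p / 4)) ^ (4 / p) := h3
    _ ≤ (C * n) ^ (4 / p) := by gcongr
    _ = C ^ (4 / p) * n ^ (4 / p) := Real.mul_rpow (by linarith) (by linarith)
    _ ≤ C ^ (4 : ℝ) * n ^ (4 / p) := by
        gcongr
        exact div_le_self (by norm_num) hp
    _ = _ := by norm_cast

lemma real2 (β γ C n p : ℝ) (hn : 1 ≤ n) (hp : 1 ≤ p)
    (hγ : n / (4 * p) ≤ γ) (h : p * γ ^ ((p + 2) / p) ≤ C * n * β) :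
    n ^ (2 / p) ≤ 4 * C * Real.exp 8 * β := by
  have hp0 : 0 < p := by linarith
  set w := n / (4 * p) with hw
  have hw0 : 0 < w := by positivity
  have e : w ^ ((p + 2) / p) = w ^ (2 / p) * w := by
    rw [show (p + 2) / p = 2 / p + 1 by field_simp; ring, Real.rpow_add_one hw0.ne']
  have h1 : p * (w ^ (2 / p) * w) ≤ C * n * β := by
    rw [← e]
    refine le_trans ?_ h
    gcongr
  have h2 : p * (w ^ (2 / p) * w) = n * (w ^ (2 / p) / 4) := by
    nth_rw 2 [hw]; field_simp
  rw [h2] at h1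
  have h3 : w ^ (2 / p) / 4 ≤ C * β := by
    refine le_of_mul_le_mul_left (a := n) ?_ (by linarith)
    linarith
  have h4 : (4 * p) ^ (2 / p) ≤ Real.exp 8 := by
    calc (4 * p) ^ (2 / p) ≤ (Real.exp (4 * p)) ^ (2 / p) := by
          gcongr; linarith [Real.add_one_le_exp (4 * p)]
      _ = Real.exp 8 := by
          rw [← Real.exp_mul]; congr 1; field_simp; norm_num
  have h5 : n = w * (4 * p) := by rw [hw]; field_simp
  have h6 : n ^ (2 / p) = w ^ (2 / p) * (4 * p) ^ (2 / p) := by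
    conv_lhs => rw [h5]
    exact Real.mul_rpow hw0.le (by positivity)
  have h7 : 0 ≤ w ^ (2 / p) := by positivity
  calc n ^ (2 / p) = w ^ (2 / p) * (4 * p) ^ (2 / p) := h6
    _ ≤ w ^ (2 / p) * Real.exp 8 := by gcongr
    _ ≤ (4 * (C * β)) * Real.exp 8 := by gcongr; linarith
    _ = _ := by ring

lemma Kc_le (n a b c m : ℕ) (hn : 1 ≤ n) (hm : m ≤ 4) :
    Kc n a b c m ≤ (5 + c + 10 * (a * b)) * n := by
  unfold Kc
  have h1 : (1 : ℝ) ≤ n := by exact_mod_cast hn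
  have h2 : (m : ℝ) ≤ 4 := by exact_mod_cast hm
  have h3 : (0 : ℝ) ≤ a * b := by positivity
  have h4 : (0 : ℝ) ≤ c := by positivity
  have h5 : (a * b : ℝ) * (m + 1) ≤ (a * b) * 5 := by gcongr; linarith
  have h6 := mul_le_mul_of_nonneg_right h5 (show (0 : ℝ) ≤ n by positivity)
  nlinarith

lemma transport_one (n a b c m : ℕ) (ha : 1 ≤ a) (hm : 1 ≤ m) (hm4 : m ≤ 4) (hme : Even m)
    (p : ℝ) (hp : 1 ≤ p) (i0 : Fin n) :
    p * ((∫ x : Fin n → ℝ, |x i0| ^ (p + m) * gd n a b c p x) / ∫ x, gd n a b c p x) ≤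
      (5 + c + 10 * (a * b)) * n *
        ((∫ x : Fin n → ℝ, |x i0| ^ m * gd n a b c p x) / ∫ x, gd n a b c p x) := by
  have hn : 1 ≤ n := by have := i0.2; omega
  have hZ := Z_pos n a b c ha p hp
  have h := transport_lim n a b c m ha hm hme p hp
  rw [sum_moment n a b c p i0 (fun y => |y| ^ (p + m)),
    sum_moment n a b c p i0 (fun y => |y| ^ m)] at h
  have hn0 : (0 : ℝ) < n := by exact_mod_cast hn
  have hA : 0 ≤ ∫ x : Fin n → ℝ, |x i0| ^ m * gd n a b c p x :=
    integral_nonneg fun x => mul_nonneg (by positivity) (gd_nonneg ..)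
  have h1 : p * (∫ x : Fin n → ℝ, |x i0| ^ (p + m) * gd n a b c p x) ≤
      Kc n a b c m * ∫ x : Fin n → ℝ, |x i0| ^ m * gd n a b c p x := by
    refine le_of_mul_le_mul_left ?_ hn0
    linarith
  have h2 := h1.trans (mul_le_mul_of_nonneg_right (Kc_le n a b c m hn hm4) hA)
  rw [← mul_div_assoc, ← mul_div_assoc]
  gcongr

lemma fourth_upper (n a b c : ℕ) (ha : 1 ≤ a) (p : ℝ) (hp : 1 ≤ p) (i0 : Fin n) :
    (∫ x : Fin n → ℝ, |x i0| ^ 4 * gd n a b c p x) / (∫ x, gd n a b c p x) ≤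
      (5 + c + 10 * (a * b) : ℝ) ^ 4 * (n : ℝ) ^ (4 / p) := by
  have hn : 1 ≤ n := by have := i0.2; omega
  have hZ := Z_pos n a b c ha p hp
  have e : ∀ y : ℝ, (|y| ^ 4) ^ ((p + 4) / 4) = |y| ^ (p + (4 : ℕ)) := by
    intro y
    rw [← Real.rpow_natCast_mul (abs_nonneg y)]
    congr 1; push_cast; ring
  have hj := jensen volume (fun x : Fin n → ℝ => |x i0| ^ 4) (gd n a b c p) ((p + 4) / 4)
    (by linarith) (fun x => by positivity) (fun x => gd_nonneg ..) (int_gd n a b c ha p hp)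
    (int_npow n a b c ha p hp i0 4)
    (by simp only [e]; exact int_moment n a b c ha p hp i0 _ (by positivity)) hZ
  simp only [e] at hj
  have ht := transport_one n a b c 4 ha (by norm_num) le_rfl (by decide) p hp i0
  have h0 : 0 ≤ (∫ x : Fin n → ℝ, |x i0| ^ 4 * gd n a b c p x) / (∫ x, gd n a b c p x) :=
    div_nonneg (integral_nonneg fun x => mul_nonneg (by positivity) (gd_nonneg ..)) hZ.le
  refine real1 _ _ _ p h0 ?_ (by exact_mod_cast hn) hp
    ((mul_le_mul_of_nonneg_left hj (by linarith)).trans ht)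
  have : (0 : ℝ) ≤ c := by positivity
  have : (0 : ℝ) ≤ a * b := by positivity
  linarith

lemma second_lower (n a b c : ℕ) (ha : 1 ≤ a) (hb : 1 ≤ b) (p : ℝ) (hp : 1 ≤ p) (i0 : Fin n) :
    (n : ℝ) ^ (2 / p) ≤ 4 * (5 + c + 10 * (a * b) : ℝ) * Real.exp 8 *
      ((∫ x : Fin n → ℝ, |x i0| ^ 2 * gd n a b c p x) / (∫ x, gd n a b c p x)) := by
  have hn : 1 ≤ n := by have := i0.2; omega
  have hn0 : (0 : ℝ) < n := by exact_mod_cast hn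
  have hp0 : 0 < p := by linarith
  have hZ := Z_pos n a b c ha p hp
  have e : ∀ y : ℝ, (|y| ^ p) ^ ((p + 2) / p) = |y| ^ (p + (2 : ℕ)) := by
    intro y
    rw [← Real.rpow_mul (abs_nonneg y)]
    congr 1; push_cast; field_simp
  have hj := jensen volume (fun x : Fin n → ℝ => |x i0| ^ p) (gd n a b c p) ((p + 2) / p)
    (by rw [le_div_iff₀ hp0]; linarith) (fun x => by positivity) (fun x => gd_nonneg ..)
    (int_gd n a b c ha p hp)
    (int_moment n a b c ha p hp i0 p hp0.le)
    (by simp only [e]; exact int_moment n a b c ha p hp i0 _ (by positivity)) hZ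
  simp only [e] at hj
  have ht := transport_one n a b c 2 ha (by norm_num) (by norm_num) (by decide) p hp i0
  refine real2 _ ((∫ x : Fin n → ℝ, |x i0| ^ p * gd n a b c p x) / (∫ x, gd n a b c p x))
    _ _ p (by exact_mod_cast hn) hp ?_ ((mul_le_mul_of_nonneg_left hj hp0.le).trans ht)
  have hm := moment_p n a b c ha hb p hp
  rw [sum_moment n a b c p i0 (fun y => |y| ^ p)] at hm
  rw [le_div_iff₀ hZ]
  refine le_of_mul_le_mul_left ?_ hn0
  refine le_trans (le_of_eq ?_) hm
  ring

lemma cross_cs (n a b c : ℕ) (ha : 1 ≤ a) (p : ℝ) (hp : 1 ≤ p) (i0 i1 : Fin n) (h01 : i0 ≠ i1) :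
    (n : ℝ) * ((∫ x : Fin n → ℝ, |x i0| ^ 2 * gd n a b c p x) / (∫ x, gd n a b c p x)) ^ 2 ≤
      (∫ x : Fin n → ℝ, |x i0| ^ 4 * gd n a b c p x) / (∫ x, gd n a b c p x) +
      (n - 1) * ((∫ x : Fin n → ℝ, x i0 ^ 2 * x i1 ^ 2 * gd n a b c p x) /
        (∫ x, gd n a b c p x)) := by
  have hn : 1 ≤ n := by have := i0.2; omega
  have hn0 : (0 : ℝ) < n := by exact_mod_cast hn
  have hZ := Z_pos n a b c ha p hp
  set Z := ∫ x, gd n a b c p x with hZdef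
  set A := ∫ x : Fin n → ℝ, |x i0| ^ 4 * gd n a b c p x with hA
  set B := ∫ x : Fin n → ℝ, x i0 ^ 2 * x i1 ^ 2 * gd n a b c p x with hB
  set D := ∫ x : Fin n → ℝ, |x i0| ^ 2 * gd n a b c p x with hD
  have e1 : (fun x : Fin n → ℝ => (∑ i, |x i| ^ 2) * gd n a b c p x) =
      fun x => ∑ i, |x i| ^ 2 * gd n a b c p x := by
    ext x; rw [Finset.sum_mul]
  have e2 : (fun x : Fin n → ℝ => (∑ i, |x i| ^ 2) ^ (2 : ℝ) * gd n a b c p x) =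
      fun x => ∑ i, ∑ j, x i ^ 2 * x j ^ 2 * gd n a b c p x := by
    ext x
    rw [Real.rpow_two, sq, Finset.sum_mul_sum, Finset.sum_mul]
    simp only [Finset.sum_mul, sq_abs]
  have hj := jensen volume (fun x : Fin n → ℝ => ∑ i, |x i| ^ 2) (gd n a b c p) 2
    (by norm_num) (fun x => by positivity) (fun x => gd_nonneg ..) (int_gd n a b c ha p hp)
    (by rw [e1]; exact integrable_finsetSum _ fun i _ => int_npow n a b c ha p hp i 2)
    (by rw [e2]; exact integrable_finsetSum _ fun i _ => integrable_finsetSum _ fun j _ =>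
          int_cross n a b c ha p hp i j) hZ
  rw [e1, e2, integral_finsetSum _ fun i _ => int_npow n a b c ha p hp i 2,
    integral_finsetSum _ fun i _ => integrable_finsetSum _ fun j _ =>
          int_cross n a b c ha p hp i j,
    sum_moment n a b c p i0 (fun y => |y| ^ 2), Real.rpow_two] at hj
  have hrow : ∀ i : Fin n, ∫ x : Fin n → ℝ, ∑ j, x i ^ 2 * x j ^ 2 * gd n a b c p x =
      A + (n - 1) * B := by
    intro i
    rw [integral_finsetSum _ fun j _ => int_cross n a b c ha p hp i j,
      ← Finset.add_sum_erase _ _ (Finset.mem_univ i)]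
    congr 1
    · rw [hA, ← moment_eq n a b c p i0 i (fun y => |y| ^ 4)]
      refine integral_congr_ae (Filter.Eventually.of_forall fun x => ?_)
      simp only [(show Even 4 by decide).pow_abs]
      ring
    · rw [Finset.sum_congr rfl (g := fun _ => B)]
      · rw [Finset.sum_const, Finset.card_erase_of_mem (Finset.mem_univ i)]
        simp [Nat.cast_sub hn]
      · intro j hj
        exact sum_moment2 n a b c p i0 i1 h01 i j (Finset.ne_of_mem_erase hj).symm
  simp only [hrow, ← hD, ← hZdef] at hj
  rw [Finset.sum_const, Finset.card_univ, Fintype.card_fin, nsmul_eq_mul] at hj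
  refine le_of_mul_le_mul_left (a := (n : ℝ)) ?_ hn0
  calc _ = (n * D / Z) ^ 2 := by ring
    _ ≤ _ := hj
    _ = _ := by ring

lemma large_n (a b c : ℕ) (ha : 1 ≤ a) (hb : 1 ≤ b) : ∃ δ : ℝ, ∃ N : ℕ, 0 < δ ∧
    ∀ (n : ℕ) (i0 i1 : Fin n), i0 ≠ i1 → N ≤ n → ∀ p : ℝ, 1 ≤ p →
      δ * (n : ℝ) ^ (4 / p) ≤ (∫ x : Fin n → ℝ, x i0 ^ 2 * x i1 ^ 2 * gd n a b c p x) /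
        (∫ x, gd n a b c p x) := by
  set C : ℝ := 5 + c + 10 * (a * b) with hC
  have hC0 : 0 < C := by positivity
  set κ : ℝ := (4 * C * Real.exp 8)⁻¹ with hκ
  have hκ0 : 0 < κ := by positivity
  obtain ⟨N, hN⟩ := exists_nat_ge (2 * C ^ 4 / κ ^ 2)
  refine ⟨κ ^ 2 / 2, N, by positivity, fun n i0 i1 h01 hn p hp => ?_⟩
  have hn1 : 1 ≤ n := by have := i0.2; omega
  have hnr : (1 : ℝ) ≤ n := by exact_mod_cast hn1
  have hZ := Z_pos n a b c ha p hp
  have h4 := fourth_upper n a b c ha p hp i0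
  have h2 := second_lower n a b c ha hb p hp i0
  have hx := cross_cs n a b c ha p hp i0 i1 h01
  rw [← hC] at h4 h2
  set α := (∫ x : Fin n → ℝ, |x i0| ^ 4 * gd n a b c p x) / (∫ x, gd n a b c p x)
  set β := (∫ x : Fin n → ℝ, |x i0| ^ 2 * gd n a b c p x) / (∫ x, gd n a b c p x)
  have hB0 : 0 ≤ (∫ x : Fin n → ℝ, x i0 ^ 2 * x i1 ^ 2 * gd n a b c p x) /
        (∫ x, gd n a b c p x) :=
    div_nonneg (integral_nonneg fun x => mul_nonneg (by positivity) (gd_nonneg ..)) hZ.le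
  set B := (∫ x : Fin n → ℝ, x i0 ^ 2 * x i1 ^ 2 * gd n a b c p x) /
        (∫ x, gd n a b c p x)
  set T := (n : ℝ) ^ (4 / p) with hT
  have hT0 : 0 < T := by positivity
  have hTs : T = ((n : ℝ) ^ (2 / p)) ^ 2 := by
    rw [hT, ← Real.rpow_mul_natCast (by positivity)]; congr 1; push_cast; ring
  have h2' : κ * (n : ℝ) ^ (2 / p) ≤ β := by
    rw [hκ, inv_mul_le_iff₀ (by positivity)]; exact h2
  have h3 : κ ^ 2 * T ≤ β ^ 2 := by
    rw [hTs, ← mul_pow]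
    exact pow_le_pow_left₀ (by positivity) h2' 2
  have hNn : (N : ℝ) ≤ n := by exact_mod_cast hn
  have h5 : 2 * C ^ 4 ≤ n * κ ^ 2 := by
    rw [← div_le_iff₀ (by positivity)]; linarith
  have h6 := mul_le_mul_of_nonneg_left h3 (show (0 : ℝ) ≤ n by positivity)
  have h7 := mul_le_mul_of_nonneg_right h5 hT0.le
  refine le_of_mul_le_mul_left (a := (n : ℝ)) ?_ (by linarith)
  nlinarith

lemma all_n (a b c : ℕ) (ha : 1 ≤ a) (N : ℕ) : ∃ δ : ℝ, 0 < δ ∧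
    ∀ (n : ℕ) (hn : 2 ≤ n), n < N → ∀ p : ℝ, 1 ≤ p →
      δ * (n : ℝ) ^ (4 / p) ≤ (∫ x : Fin n → ℝ, x ⟨0, by omega⟩ ^ 2 * x ⟨1, by omega⟩ ^ 2 *
        gd n a b c p x) / (∫ x, gd n a b c p x) := by
  induction N with
  | zero => exact ⟨1, one_pos, fun n _ h => by omega⟩
  | succ N ih =>
    obtain ⟨δ, hδ, h⟩ := ih
    by_cases hN : 2 ≤ N
    · obtain ⟨ε, hε, h'⟩ := small_n N a b c ha ⟨0, by omega⟩ ⟨1, by omega⟩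
      have hN1 : (1 : ℝ) ≤ N := by exact_mod_cast (by omega : 1 ≤ N)
      refine ⟨min δ (ε / (N : ℝ) ^ 4), lt_min hδ (by positivity), fun n hn hnN p hp => ?_⟩
      have hT : 0 ≤ (n : ℝ) ^ (4 / p) := by positivity
      rcases Nat.lt_succ_iff_lt_or_eq.1 hnN with h1 | h1
      · exact (mul_le_mul_of_nonneg_right (min_le_left _ _) hT).trans (h n hn h1 p hp)
      · subst h1
        have hZ := Z_pos n a b c ha p hp
        refine (mul_le_mul_of_nonneg_right (min_le_right _ _) hT).trans ?_
        rw [le_div_iff₀ hZ]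
        refine le_trans ?_ (h' p hp)
        refine mul_le_mul_of_nonneg_right ?_ hZ.le
        have : (n : ℝ) ^ (4 / p) ≤ (n : ℝ) ^ 4 := by
          rw [← Real.rpow_natCast]
          exact Real.rpow_le_rpow_of_exponent_le hN1 (by
            push_cast; exact div_le_self (by norm_num) hp)
        calc ε / (n : ℝ) ^ 4 * (n : ℝ) ^ (4 / p) ≤ ε / (n : ℝ) ^ 4 * (n : ℝ) ^ 4 := by gcongr
          _ = ε := by field_simp
    · exact ⟨δ, hδ, fun n hn hnN p hp => by omega⟩

lemma cross_le_fourth (n a b c : ℕ) (ha : 1 ≤ a) (p : ℝ) (hp : 1 ≤ p) (i0 i1 : Fin n) :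
    (∫ x : Fin n → ℝ, x i0 ^ 2 * x i1 ^ 2 * gd n a b c p x) / (∫ x, gd n a b c p x) ≤
      (∫ x : Fin n → ℝ, |x i0| ^ 4 * gd n a b c p x) / (∫ x, gd n a b c p x) := by
  have hZ := Z_pos n a b c ha p hp
  refine div_le_div_of_nonneg_right ?_ hZ.le
  have i1' := int_npow n a b c ha p hp i0 4
  have i2' := int_npow n a b c ha p hp i1 4
  have h := integral_mono (int_cross n a b c ha p hp i0 i1) ((i1'.add i2').const_mul (1 / 2))
    (fun x => by
      have hg := gd_nonneg n a b c p x
      simp only [Pi.add_apply, (show Even 4 by decide).pow_abs]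
      nlinarith [mul_nonneg (sq_nonneg (x i0 ^ 2 - x i1 ^ 2)) hg])
  have k := integral_add i1' i2'
  rw [integral_const_mul] at h
  simp only [Pi.add_apply] at h
  rw [k, moment_eq n a b c p i0 i1 (fun y => |y| ^ 4)] at h
  linarith

/-- For fixed `a, b ≥ 1` and `c ≥ 0` there are constants `c₁, c₂ > 0`
(depending only on `a, b, c`) such that for all `n ≥ 2` and `p ∈ [1,∞)`,
`c₁ n^{4/p} ≤ M_p(x₁⁴)/M_p(1) ≤ c₂ n^{4/p}` and
`c₁ n^{4/p} ≤ M_p(x₁²x₂²)/M_p(1) ≤ c₂ n^{4/p}`. -/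
theorem statement8 (a b c : ℕ) (ha : 1 ≤ a) (hb : 1 ≤ b) :
    ∃ c₁ c₂ : ℝ, 0 < c₁ ∧ 0 < c₂ ∧
      ∀ (n : ℕ) (hn : 2 ≤ n) (p : ℝ), 1 ≤ p →
        (c₁ * (n : ℝ) ^ (4 / p) ≤
            Mp n a b c p (fun x => x ⟨0, by omega⟩ ^ 4) / Mp n a b c p (fun _ => 1) ∧
          Mp n a b c p (fun x => x ⟨0, by omega⟩ ^ 4) / Mp n a b c p (fun _ => 1) ≤
            c₂ * (n : ℝ) ^ (4 / p)) ∧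
        (c₁ * (n : ℝ) ^ (4 / p) ≤
            Mp n a b c p (fun x => x ⟨0, by omega⟩ ^ 2 * x ⟨1, by omega⟩ ^ 2) /
              Mp n a b c p (fun _ => 1) ∧
          Mp n a b c p (fun x => x ⟨0, by omega⟩ ^ 2 * x ⟨1, by omega⟩ ^ 2) /
              Mp n a b c p (fun _ => 1) ≤
            c₂ * (n : ℝ) ^ (4 / p)) := by
  obtain ⟨δ₁, N, hδ₁, hlarge⟩ := large_n a b c ha hb
  obtain ⟨δ₂, hδ₂, hsmall⟩ := all_n a b c ha N
  refine ⟨min δ₁ δ₂, (5 + c + 10 * (a * b) : ℝ) ^ 4, lt_min hδ₁ hδ₂, by positivity,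
    fun n hn p hp => ?_⟩
  have hT : 0 ≤ (n : ℝ) ^ (4 / p) := by positivity
  simp only [Mp_eq, one_mul]
  have h4 := fourth_upper n a b c ha p hp ⟨0, by omega⟩
  have hx := cross_le_fourth n a b c ha p hp ⟨0, by omega⟩ ⟨1, by omega⟩
  have hlow : min δ₁ δ₂ * (n : ℝ) ^ (4 / p) ≤
      (∫ x : Fin n → ℝ, x ⟨0, by omega⟩ ^ 2 * x ⟨1, by omega⟩ ^ 2 *
        gd n a b c p x) / (∫ x, gd n a b c p x) := by
    rcases lt_or_ge n N with h | h
    · exact (mul_le_mul_of_nonneg_right (min_le_right _ _) hT).trans (hsmall n hn h p hp)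
    · exact (mul_le_mul_of_nonneg_right (min_le_left _ _) hT).trans
        (hlarge n ⟨0, by omega⟩ ⟨1, by omega⟩ (by simp) h p hp)
  simp only [(show Even 4 by decide).pow_abs] at h4 hx
  exact ⟨⟨hlow.trans hx, h4⟩, hlow, hx.trans h4⟩
end

section
/- Fix an integer n ≥ 1, a positive integer b, a nonnegative integer c and a real p ≥ 1, and let M_p be taken with respect to the density f_{2,b,c}(x)·e^{−‖x‖_p^p} (i.e. the case a = 2), with d_n = b n(n−1) + (c+1)n. Then ((2 d_n + (1 − c) n)/n) · M_p(‖x‖₂²) = p · M_p(‖x‖_{p+2}^{p+2}), where ‖x‖₂² = ∑_{i=1}^n x_i² and ‖x‖_{p+2}^{p+2} = ∑_{i=1}^n |x_i|^{p+2}. -/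
open MeasureTheory Real

lemma aux_sum_lt {R : Type*} [CommRing R] (n : ℕ) (y : Fin n → R) :
    (∑ i, ∑ j, if i < j then y i + y j else 0) = ((n : R) - 1) * ∑ i, y i := by
  have h1 : ∀ i j : Fin n, (if i < j then y i + y j else 0) =
      (if i < j then y i else 0) + (if i < j then y j else 0) := by
    intro i j; split_ifs <;> simp
  simp_rw [h1, Finset.sum_add_distrib]
  rw [Finset.sum_comm (f := fun i j => if i < j then y j else 0), ← Finset.sum_add_distrib,
    Finset.mul_sum]
  refine Finset.sum_congr rfl fun i _ => ?_
  rw [← Finset.sum_add_distrib]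
  have : ∀ j : Fin n, ((if i < j then y i else 0) + (if j < i then y i else 0)) =
      y i - if j = i then y i else 0 := by
    intro j
    rcases lt_trichotomy i j with h | h | h
    · simp [h, h.not_gt, h.ne']
    · simp [h]
    · simp [h, h.not_gt, h.ne]
  simp_rw [this, Finset.sum_sub_distrib]
  simp
  ring

lemma aux_eig_prod {A : Type*} [CommRing A] [Algebra ℝ A] (D : Derivation ℝ A A) {ι : Type*}
    (s : Finset ι) (u l : ι → A) (h : ∀ i ∈ s, D (u i) = l i * u i) :
    D (∏ i ∈ s, u i) = (∑ i ∈ s, l i) * ∏ i ∈ s, u i := by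
  classical
  induction s using Finset.induction_on with
  | empty => simp
  | insert a s ha ih =>
    rw [Finset.prod_insert ha, Finset.sum_insert ha, D.leibniz, h a (by simp),
      ih (fun i hi => h i (by simp [hi]))]
    simp only [smul_eq_mul]; ring

lemma aux_eig_pow {A : Type*} [CommRing A] [Algebra ℝ A] (D : Derivation ℝ A A)
    (u l : A) (h : D u = l * u) (k : ℕ) : D (u ^ k) = (k * l) * u ^ k := by
  have := aux_eig_prod D (Finset.range k) (fun _ => u) (fun _ => l) (fun _ _ => h)
  simpa using this

open MvPolynomial in
noncomputable def auxQ (n b c : ℕ) : MvPolynomial (Fin n) ℝ :=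
  (∏ i : Fin n, ∏ j : Fin n, if i < j then (X i ^ 2 - X j ^ 2) ^ b else 1) *
    ∏ i : Fin n, X i ^ c

lemma auxQ_abs (n b c : ℕ) (x : Fin n → ℝ) :
    |MvPolynomial.eval x (auxQ n b c)| = fabc n 2 b c x := by
  simp only [auxQ, fabc, map_mul, map_prod, abs_mul, Finset.abs_prod]
  congr 1
  · refine Finset.prod_congr rfl fun i _ => Finset.prod_congr rfl fun j _ => ?_
    split_ifs <;> simp
  · simp

lemma aux_eig_gen {A : Type*} [CommRing A] [Algebra ℝ A] (D : Derivation ℝ A A) (n b c : ℕ)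
    (X : Fin n → A) (hDX : ∀ i, D (X i) = X i ^ 3) :
    D ((∏ i : Fin n, ∏ j : Fin n, if i < j then (X i ^ 2 - X j ^ 2) ^ b else 1) *
      ∏ i : Fin n, X i ^ c) =
      ((2 * (b : A) * ((n : A) - 1) + (c : A)) * ∑ i : Fin n, X i ^ 2) *
      ((∏ i : Fin n, ∏ j : Fin n, if i < j then (X i ^ 2 - X j ^ 2) ^ b else 1) *
      ∏ i : Fin n, X i ^ c) := by
  have h1 := aux_eig_prod D Finset.univ (fun i => X i ^ c) (fun i => (c : A) * X i ^ 2)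
    (fun i _ => aux_eig_pow D _ _ (by rw [hDX]; ring) c)
  have hij : ∀ i j : Fin n, D (if i < j then (X i ^ 2 - X j ^ 2) ^ b else 1) =
      (if i < j then 2 * (b : A) * X i ^ 2 + 2 * (b : A) * X j ^ 2 else 0) *
        (if i < j then (X i ^ 2 - X j ^ 2) ^ b else 1) := by
    intro i j
    split_ifs with h
    · rw [aux_eig_pow D _ (2 * (X i ^ 2 + X j ^ 2))]
      · ring
      · rw [map_sub, D.leibniz_pow, D.leibniz_pow, hDX, hDX]
        simp only [smul_eq_mul, nsmul_eq_mul]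
        push_cast
        ring
    · simp
  have h2 := aux_eig_prod D Finset.univ
    (fun i : Fin n => ∏ j : Fin n, if i < j then (X i ^ 2 - X j ^ 2) ^ b else 1) _
    (fun i _ => aux_eig_prod D Finset.univ _ _ (fun j _ => hij i j))
  rw [aux_sum_lt n (fun i => 2 * (b : A) * X i ^ 2)] at h2
  rw [D.leibniz, h1, h2]
  simp only [smul_eq_mul, ← Finset.mul_sum]
  ring

open MvPolynomial in
lemma aux_D_sum (n : ℕ) (P : MvPolynomial (Fin n) ℝ) :
    mkDerivation ℝ (fun i : Fin n => (X i ^ 3 : MvPolynomial (Fin n) ℝ)) P =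
      ∑ i : Fin n, X i ^ 3 * pderiv i P := by
  induction P using MvPolynomial.induction_on with
  | C a => simp
  | add P R hP hR => simp only [map_add, hP, hR, mul_add, Finset.sum_add_distrib]
  | mul_X P j hP =>
    rw [Derivation.leibniz, mkDerivation_X, hP]
    simp only [pderiv_mul, mul_add, Finset.sum_add_distrib, smul_eq_mul]
    rw [add_comm]
    congr 1
    · rw [Finset.mul_sum]
      exact Finset.sum_congr rfl fun i _ => by ring
    · rw [Finset.sum_eq_single j]
      · rw [pderiv_X_self]; ring
      · intro i _ hi
        rw [pderiv_X_of_ne hi.symm]; ring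
      · simp

open MvPolynomial in
lemma auxQ_eig (n b c : ℕ) :
    (∑ i : Fin n, X i ^ 3 * pderiv i (auxQ n b c)) =
      ((2 * (b : MvPolynomial (Fin n) ℝ) * ((n : MvPolynomial (Fin n) ℝ) - 1) +
        (c : MvPolynomial (Fin n) ℝ)) * ∑ i : Fin n, X i ^ 2) * auxQ n b c := by
  rw [← aux_D_sum]
  exact aux_eig_gen _ n b c _ (fun i => mkDerivation_X _ _ _)

lemma aux_int1 (p s : ℝ) (hp : 1 ≤ p) (hs : 0 ≤ s) :
    Integrable (fun t : ℝ => |t| ^ s * Real.exp (-|t| ^ p)) := by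
  have h := integrableOn_rpow_mul_exp_neg_rpow (p := p) (s := s) (by linarith) (by linarith)
  have h1 : IntegrableOn (fun t : ℝ => |t| ^ s * Real.exp (-|t| ^ p)) (Set.Ioi 0) := by
    refine h.congr_fun (fun t ht => ?_) measurableSet_Ioi
    simp only [Set.mem_Ioi] at ht
    simp [abs_of_pos ht]
  have h2 : IntegrableOn (fun t : ℝ => |t| ^ s * Real.exp (-|t| ^ p)) (Set.Iic 0) := by
    have h3 := (integrableOn_Ici_iff_integrableOn_Ioi (μ := volume) (b := (0:ℝ))).2 h1
    have h4 := IntegrableOn.comp_neg_Iic (c := 0) (f := fun t : ℝ => |t| ^ s * Real.exp (-|t| ^ p))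
      (by simpa using h3)
    simpa using h4
  have := h2.union h1
  rwa [Set.Iic_union_Ioi, integrableOn_univ] at this

lemma aux_intn (n : ℕ) (p r : ℝ) (hp : 1 ≤ p) (hr : 0 ≤ r) (j : Fin n)
    (P : MvPolynomial (Fin n) ℝ) :
    Integrable (fun x : Fin n → ℝ => |x j| ^ r * MvPolynomial.eval x P *
      Real.exp (-∑ i, |x i| ^ p)) := by
  induction P using MvPolynomial.induction_on' with
  | add P Q hP hQ =>
    refine (hP.add hQ).congr (Filter.Eventually.of_forall fun x => ?_)
    simp only [Pi.add_apply, map_add]; ring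
  | monomial u a =>
    have h := Integrable.fintype_prod (𝕜 := ℝ) (μ := fun _ : Fin n => (volume : Measure ℝ))
      (f := fun i t => |t| ^ ((u i : ℝ) + if i = j then r else 0) * Real.exp (-|t| ^ p))
      (fun i => aux_int1 p _ hp (by split_ifs <;> positivity))
    have h2 := h.const_mul a
    rw [← volume_pi] at h2
    refine h2.mono ?_ (Filter.Eventually.of_forall fun x => ?_)
    · have : Continuous fun x : Fin n → ℝ => MvPolynomial.eval x (MvPolynomial.monomial u a) :=
        MvPolynomial.continuous_eval _
      have := this.measurable
      apply Measurable.aestronglyMeasurable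
      fun_prop
    · rw [MvPolynomial.eval_monomial, Finset.prod_mul_distrib, ← Real.exp_sum,
        Finset.sum_neg_distrib]
      have : ∏ i, |x i| ^ ((u i : ℝ) + if i = j then r else 0) =
          (∏ i, |x i| ^ u i) * |x j| ^ r := by
        have : ∀ i, |x i| ^ ((u i : ℝ) + if i = j then r else 0) =
          |x i| ^ u i * if i = j then |x i| ^ r else 1 := by
          intro i
          split_ifs
          · rw [Real.rpow_add_of_nonneg (abs_nonneg _) (by positivity) hr, Real.rpow_natCast]
          · simp
        simp_rw [this]
        rw [Finset.prod_mul_distrib]; simp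
      rw [this, Finsupp.prod_fintype _ _ (by simp)]
      simp only [norm_mul, Real.norm_eq_abs, Finset.abs_prod, abs_pow, abs_abs]
      apply le_of_eq; ring

lemma aux_tendsto (p : ℝ) (hp : 1 ≤ p) (q : Polynomial ℝ) :
    Filter.Tendsto (fun t : ℝ => |q.eval t| * Real.exp (-|t| ^ p)) Filter.atTop (nhds 0) := by
  have h := (q.tendsto_div_exp_atTop).abs
  simp only [abs_zero] at h
  refine squeeze_zero' (Filter.Eventually.of_forall fun t => by positivity) ?_ h
  filter_upwards [Filter.eventually_ge_atTop 1] with t ht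
  rw [abs_div, abs_of_pos (Real.exp_pos t), div_eq_mul_inv, ← Real.exp_neg]
  gcongr
  rw [abs_of_nonneg (by linarith)]
  simpa using Real.rpow_le_rpow_of_exponent_le ht hp

lemma aux_1d (p : ℝ) (hp : 1 ≤ p) (q : Polynomial ℝ)
    (hi : Integrable (fun t : ℝ => (3 * t ^ 2 * |q.eval t| +
      q.eval t / |q.eval t| * (t ^ 3 * q.derivative.eval t) -
      p * (|t| ^ (p + 2) * |q.eval t|)) * Real.exp (-|t| ^ p))) :
    ∫ t : ℝ, (3 * t ^ 2 * |q.eval t| + q.eval t / |q.eval t| * (t ^ 3 * q.derivative.eval t) -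
      p * (|t| ^ (p + 2) * |q.eval t|)) * Real.exp (-|t| ^ p) = 0 := by
  by_cases hq : q = 0
  · simp [hq]
  set G : ℝ → ℝ := fun t => t ^ 3 * |q.eval t| * Real.exp (-|t| ^ p) with hG
  have hlim := intervalIntegral_tendsto_integral hi Filter.tendsto_neg_atTop_atBot
    (Filter.tendsto_id (α := ℝ))
  have hGc : Continuous G := by
    have : Continuous fun t : ℝ => |t| ^ p :=
      continuous_abs.rpow_const (fun _ => Or.inr (by linarith))
    have := q.continuous
    fun_prop
  have hGd : ∀ t, t ≠ 0 → q.eval t ≠ 0 → HasDerivAt G ((3 * t ^ 2 * |q.eval t| +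
      q.eval t / |q.eval t| * (t ^ 3 * q.derivative.eval t) -
      p * (|t| ^ (p + 2) * |q.eval t|)) * Real.exp (-|t| ^ p)) t := by
    intro t ht hqt
    have d1 : HasDerivAt (fun t : ℝ => t ^ 3) (3 * t ^ 2) t := by
      simpa using hasDerivAt_pow 3 t
    have d2 := (hasDerivAt_abs hqt).comp t (q.hasDerivAt t)
    have d3 := ((hasDerivAt_abs ht).rpow_const (p := p) (Or.inr hp)).neg.exp
    have d := (d1.mul d2).mul d3
    have hsg : ∀ u : ℝ, u ≠ 0 → ((SignType.sign u : SignType) : ℝ) = u / |u| := by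
      intro u hu
      rw [eq_div_iff (abs_ne_zero.2 hu), sign_mul_abs]
    refine HasDerivAt.congr_deriv (f := G) d ?_
    have e : |t| ^ (p + 2) = |t| ^ (p - 1) * |t| ^ 3 := by
      rw [← Real.rpow_natCast, ← Real.rpow_add (abs_pos.2 ht)]; norm_num; ring_nf
    have e2 : t / |t| * t ^ 3 = |t| ^ 3 := by
      have : |t| ≠ 0 := abs_ne_zero.2 ht
      have h4 : |t| ^ 4 = t ^ 4 := by
        rw [← abs_pow]; exact abs_of_nonneg (by positivity)
      field_simp
      linarith
    simp only [hsg t ht, hsg _ hqt, Function.comp, e, ← e2, Pi.mul_apply, Pi.neg_apply]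
    ring
  have heq : ∀ T : ℝ, ∫ t in (-T)..T, (3 * t ^ 2 * |q.eval t| +
      q.eval t / |q.eval t| * (t ^ 3 * q.derivative.eval t) -
      p * (|t| ^ (p + 2) * |q.eval t|)) * Real.exp (-|t| ^ p) = G T - G (-T) := by
    intro T
    refine integral_eq_of_hasDerivAt_off_countable G _
      (s := {0} ∪ {t | q.eval t = 0}) ?_ hGc.continuousOn ?_ hi.intervalIntegrable
    · refine ((Set.finite_singleton 0).union ?_).countable
      refine (q.roots.toFinset.finite_toSet).subset fun t ht => ?_
      simpa [hq] using ht
    · rintro t ⟨_, ht⟩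
      simp only [Set.mem_union, Set.mem_singleton_iff, Set.mem_setOf_eq, not_or] at ht
      exact hGd t ht.1 ht.2
  have hG1 : Filter.Tendsto G Filter.atTop (nhds 0) := by
    rw [tendsto_zero_iff_abs_tendsto_zero]
    refine (aux_tendsto p hp (Polynomial.X ^ 3 * q)).congr fun t => ?_
    simp [hG, abs_mul]
  have hG2 : Filter.Tendsto (fun T => G (-T)) Filter.atTop (nhds 0) := by
    rw [tendsto_zero_iff_abs_tendsto_zero]
    refine (aux_tendsto p hp (Polynomial.X ^ 3 * q.comp (-Polynomial.X))).congr fun t => ?_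
    simp [hG, abs_mul]
  have hlim2 := hG1.sub hG2
  rw [sub_zero] at hlim2
  refine tendsto_nhds_unique hlim (hlim2.congr fun T => (heq T).symm)

noncomputable def auxH (n : ℕ) (p : ℝ) (Q : MvPolynomial (Fin n) ℝ) (i : Fin n)
    (x : Fin n → ℝ) : ℝ :=
  (3 * x i ^ 2 * |MvPolynomial.eval x Q| +
      MvPolynomial.eval x Q / |MvPolynomial.eval x Q| *
        (x i ^ 3 * MvPolynomial.eval x (MvPolynomial.pderiv i Q)) -
      p * (|x i| ^ (p + 2) * |MvPolynomial.eval x Q|)) * Real.exp (-∑ i, |x i| ^ p)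

lemma aux_int_abs (n : ℕ) (p r : ℝ) (hp : 1 ≤ p) (hr : 0 ≤ r) (j : Fin n)
    (Q : MvPolynomial (Fin n) ℝ) :
    Integrable (fun x : Fin n → ℝ => |x j| ^ r * |MvPolynomial.eval x Q| *
      Real.exp (-∑ i, |x i| ^ p)) := by
  refine (aux_intn n p r hp hr j Q).norm.congr (Filter.Eventually.of_forall fun x => ?_)
  simp only [norm_mul, Real.norm_eq_abs, Real.abs_exp]
  rw [abs_of_nonneg (Real.rpow_nonneg (abs_nonneg (x j)) r)]

lemma aux_int_sq (n : ℕ) (p : ℝ) (hp : 1 ≤ p) (j : Fin n)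
    (Q : MvPolynomial (Fin n) ℝ) :
    Integrable (fun x : Fin n → ℝ => x j ^ 2 * |MvPolynomial.eval x Q| *
      Real.exp (-∑ i, |x i| ^ p)) := by
  refine (aux_int_abs n p 2 hp (by norm_num) j Q).congr (Filter.Eventually.of_forall fun x => ?_)
  simp

lemma aux_int_sgn (n : ℕ) (p : ℝ) (hp : 1 ≤ p) (i : Fin n) (Q : MvPolynomial (Fin n) ℝ) :
    Integrable (fun x : Fin n → ℝ => MvPolynomial.eval x Q / |MvPolynomial.eval x Q| *
        (x i ^ 3 * MvPolynomial.eval x (MvPolynomial.pderiv i Q)) *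
        Real.exp (-∑ i, |x i| ^ p)) := by
  refine (aux_intn n p 0 hp le_rfl i (MvPolynomial.X i ^ 3 * MvPolynomial.pderiv i Q)).mono ?_
    (Filter.Eventually.of_forall fun x => ?_)
  · have h1 := (MvPolynomial.continuous_eval Q).measurable
    have h2 := (MvPolynomial.continuous_eval (MvPolynomial.pderiv i Q)).measurable
    apply Measurable.aestronglyMeasurable
    have h3 : Measurable fun x : Fin n → ℝ => |MvPolynomial.eval x Q| :=
      continuous_abs.measurable.comp h1
    fun_prop
  · simp only [norm_mul, Real.rpow_zero, norm_one, one_mul, map_mul, map_pow,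
      MvPolynomial.eval_X, norm_div, Real.norm_eq_abs, abs_abs]
    have : |MvPolynomial.eval x Q| / |MvPolynomial.eval x Q| ≤ 1 := div_self_le_one _
    calc _ = (|MvPolynomial.eval x Q| / |MvPolynomial.eval x Q|) * _ := by rw [mul_assoc]
      _ ≤ 1 * _ := by gcongr
      _ = _ := by rw [one_mul]

lemma auxH_int (n : ℕ) (p : ℝ) (hp : 1 ≤ p) (Q : MvPolynomial (Fin n) ℝ) (i : Fin n) :
    Integrable (auxH n p Q i) := by
  have h1 := (aux_int_sq n p hp i Q).const_mul 3
  have h2 := aux_int_sgn n p hp i Q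
  have h3 := (aux_int_abs n p (p + 2) hp (by linarith) i Q).const_mul p
  refine ((h1.add h2).sub h3).congr (Filter.Eventually.of_forall fun x => ?_)
  simp only [auxH, Pi.add_apply, Pi.sub_apply]
  ring

noncomputable def auxq {m : ℕ} (Q : MvPolynomial (Fin (m + 1)) ℝ) (i : Fin (m + 1))
    (y : Fin m → ℝ) : Polynomial ℝ :=
  MvPolynomial.aeval (i.insertNth (α := fun _ => Polynomial ℝ) Polynomial.X
    (fun j => Polynomial.C (y j))) Q

lemma auxq_eval {m : ℕ} (Q : MvPolynomial (Fin (m + 1)) ℝ) (i : Fin (m + 1))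
    (y : Fin m → ℝ) (t : ℝ) :
    (auxq Q i y).eval t = MvPolynomial.eval (i.insertNth (α := fun _ => ℝ) t y) Q := by
  unfold auxq
  induction Q using MvPolynomial.induction_on with
  | C a => simp [MvPolynomial.algebraMap_eq]
  | add P R hP hR => simp [hP, hR]
  | mul_X P j hP =>
    rw [map_mul, Polynomial.eval_mul, hP, map_mul]
    congr 1
    rw [MvPolynomial.aeval_X, MvPolynomial.eval_X]
    refine Fin.succAboveCases i ?_ ?_ j
    · simp
    · intro k; simp

lemma auxq_deriv {m : ℕ} (Q : MvPolynomial (Fin (m + 1)) ℝ) (i : Fin (m + 1))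
    (y : Fin m → ℝ) :
    (auxq Q i y).derivative = auxq (MvPolynomial.pderiv i Q) i y := by
  unfold auxq
  induction Q using MvPolynomial.induction_on with
  | C a => simp
  | add P R hP hR => simp [hP, hR]
  | mul_X P j hP =>
    rw [map_mul, Polynomial.derivative_mul, hP, MvPolynomial.pderiv_mul, map_add, map_mul, map_mul]
    congr 2
    rw [MvPolynomial.aeval_X]
    refine Fin.succAboveCases i ?_ ?_ j
    · simp
    · intro k
      rw [MvPolynomial.pderiv_X_of_ne (Fin.succAbove_ne i k)]
      simp

lemma auxH_zero (n : ℕ) (p : ℝ) (hp : 1 ≤ p) (Q : MvPolynomial (Fin n) ℝ) (i : Fin n) :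
    ∫ x, auxH n p Q i x = 0 := by
  cases n with
  | zero => exact i.elim0
  | succ m =>
    have mp := (volume_preserving_piFinSuccAbove (fun _ : Fin (m + 1) => ℝ) i).symm
    rw [← mp.integral_comp' (g := auxH (m + 1) p Q i)]
    have hI : Integrable (fun z : ℝ × (Fin m → ℝ) => auxH (m + 1) p Q i
        ((MeasurableEquiv.piFinSuccAbove (fun _ : Fin (m + 1) => ℝ) i).symm z)) :=
      (mp.integrable_comp_emb (MeasurableEquiv.measurableEmbedding _)).2 (auxH_int _ p hp Q i)
    rw [Measure.volume_eq_prod] at hI ⊢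
    rw [integral_prod_symm _ hI]
    have hae := hI.prod_left_ae
    rw [← integral_zero (Fin m → ℝ) ℝ (μ := volume)]
    refine integral_congr_ae ?_
    filter_upwards [hae] with y hy
    have key : ∀ t : ℝ, auxH (m + 1) p Q i
        ((MeasurableEquiv.piFinSuccAbove (fun _ : Fin (m + 1) => ℝ) i).symm (t, y)) =
        ((3 * t ^ 2 * |(auxq Q i y).eval t| + (auxq Q i y).eval t / |(auxq Q i y).eval t| *
          (t ^ 3 * (auxq Q i y).derivative.eval t) -
          p * (|t| ^ (p + 2) * |(auxq Q i y).eval t|)) * Real.exp (-|t| ^ p)) *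
          Real.exp (-∑ j, |y j| ^ p) := by
      intro t
      have : (MeasurableEquiv.piFinSuccAbove (fun _ : Fin (m + 1) => ℝ) i).symm (t, y) =
        i.insertNth (α := fun _ => ℝ) t y := rfl
      rw [this, auxq_deriv, auxq_eval, auxq_eval, auxH, Fin.sum_univ_succAbove _ i]
      simp only [Fin.insertNth_apply_same, Fin.insertNth_apply_succAbove]
      rw [neg_add, Real.exp_add]
      ring
    simp_rw [key] at hy ⊢
    rw [integral_mul_const, aux_1d p hp, zero_mul]
    have := hy.mul_const (Real.exp (-∑ j, |y j| ^ p))⁻¹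
    refine this.congr (Filter.Eventually.of_forall fun t => ?_)
    exact mul_inv_cancel_right₀ (Real.exp_pos _).ne' _

/-- identity (12) of the paper, for `a = 2`, where
`d_n = b n (n-1) + (c+1) n`:
`((2 d_n + (1-c) n)/n) · M_p(‖x‖₂²) = p · M_p(‖x‖_{p+2}^{p+2})`. -/
theorem statement11 (n b c : ℕ) (hn : 1 ≤ n) (hb : 1 ≤ b) (p : ℝ) (hp : 1 ≤ p) :
    (2 * ((b : ℝ) * n * ((n : ℝ) - 1) + ((c : ℝ) + 1) * n) + (1 - (c : ℝ)) * n) / n *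
        Mp n 2 b c p (fun x => ∑ i, x i ^ 2) =
      p * Mp n 2 b c p (fun x => ∑ i, |x i| ^ (p + 2)) := by
  have hn0 : (n : ℝ) ≠ 0 := by positivity
  have hcoef : (2 * ((b : ℝ) * n * ((n : ℝ) - 1) + ((c : ℝ) + 1) * n) + (1 - (c : ℝ)) * n) / n
      = 3 + (2 * b * ((n : ℝ) - 1) + c) := by
    field_simp; ring
  rw [hcoef]
  unfold Mp
  rw [← integral_const_mul, ← integral_const_mul, ← sub_eq_zero]
  simp only [← auxQ_abs]
  have h1 : Integrable (fun x : Fin n → ℝ => (∑ i, x i ^ 2) *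
      |MvPolynomial.eval x (auxQ n b c)| * Real.exp (-∑ i, |x i| ^ p)) := by
    simp_rw [Finset.sum_mul]
    exact integrable_finset_sum _ fun i _ => aux_int_sq n p hp i _
  have h2 : Integrable (fun x : Fin n → ℝ => (∑ i, |x i| ^ (p + 2)) *
      |MvPolynomial.eval x (auxQ n b c)| * Real.exp (-∑ i, |x i| ^ p)) := by
    simp_rw [Finset.sum_mul]
    exact integrable_finset_sum _ fun i _ => aux_int_abs n p (p + 2) hp (by linarith) i _
  rw [← integral_sub (h1.const_mul _) (h2.const_mul _)]
  have h3 : ∫ x, ∑ i, auxH n p (auxQ n b c) i x = 0 := by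
    rw [integral_finset_sum _ fun i _ => auxH_int n p hp _ i]
    exact Finset.sum_eq_zero fun i _ => auxH_zero n p hp _ i
  rw [← h3]
  congr 1
  funext x
  have he := congrArg (MvPolynomial.eval x) (auxQ_eig n b c)
  simp only [map_sum, map_mul, map_pow, MvPolynomial.eval_X, map_add, map_sub, map_one,
    map_natCast, map_ofNat] at he
  simp only [auxH]
  rw [← Finset.sum_mul, Finset.sum_sub_distrib, Finset.sum_add_distrib, ← Finset.mul_sum,
    ← Finset.mul_sum, ← Finset.sum_mul, ← Finset.sum_mul, ← Finset.mul_sum, he]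
  have hs : ∀ u : ℝ, u / |u| * u = |u| := by
    intro u
    by_cases hu : u = 0
    · simp [hu]
    · have : |u| ≠ 0 := abs_ne_zero.2 hu
      field_simp
      rw [sq_abs]
  set E := MvPolynomial.eval x (auxQ n b c)
  have hs' := hs E
  generalize E / |E| = σ at *
  rw [← hs']
  ring
end

section
/- Let β ∈ {1,2}, and let M_p be taken with respect to the density f_{2,β,β−1}(x)·e^{−‖x‖_p^p} on ℝⁿ (the density associated with the Schatten balls of M_n(ℝ) and M_n(ℂ) respectively). For every ε > 0 there exists N = N(ε) such that for every integer n ≥ N and every real p ∈ [1,∞), M_p(x₁⁴)/M_p(1) ≥ (3/2 − ε) · (M_p(x₁²)/M_p(1))². -/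
open MeasureTheory Real

/-! ### One-dimensional facts -/

lemma st_half (G G' : ℝ → ℝ) (S : Set ℝ) (hS : S.Countable) (p : ℝ) (hp : 1 ≤ p)
    (hG : Continuous G) (hd : ∀ s, s ∉ S → HasDerivAt G (G' s) s)
    (hi : Integrable (fun s => G' s * Real.exp (-|s| ^ p)))
    (h0 : G 0 = 0) (hpos : ∀ s, 0 ≤ s → 0 ≤ G s) (R : ℝ) (hR : 0 ≤ R) :
    0 ≤ ∫ s in (0 : ℝ)..R, G' s * Real.exp (-|s| ^ p) := by
  have hcw : Continuous (fun s : ℝ => Real.exp (-|s| ^ p)) := by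
    refine Real.continuous_exp.comp (Continuous.neg ?_)
    exact continuous_abs.rpow_const (fun x => Or.inr (by linarith))
  have hc2 : Continuous (fun s : ℝ => G s * (p * |s| ^ (p - 1)) * Real.exp (-|s| ^ p)) := by
    refine (hG.mul (continuous_const.mul ?_)).mul hcw
    exact continuous_abs.rpow_const (fun x => Or.inr (by linarith))
  have key := MeasureTheory.integral_eq_of_hasDerivAt_off_countable
    (fun s => G s * Real.exp (-|s| ^ p))
    (fun s => G' s * Real.exp (-|s| ^ p) - G s * (p * |s| ^ (p - 1)) * Real.exp (-|s| ^ p))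
    (a := 0) (b := R) hS (hG.mul hcw).continuousOn ?_ ?_
  · rw [intervalIntegral.integral_sub hi.intervalIntegrable (hc2.intervalIntegrable _ _)] at key
    have h1 : 0 ≤ ∫ s in (0 : ℝ)..R, G s * (p * |s| ^ (p - 1)) * Real.exp (-|s| ^ p) := by
      refine intervalIntegral.integral_nonneg hR ?_
      intro s hs
      have := hpos s hs.1
      have : 0 ≤ p := by linarith
      positivity
    have h2 : 0 ≤ G R * Real.exp (-|R| ^ p) := mul_nonneg (hpos R hR) (Real.exp_pos _).le
    simp only [h0, zero_mul, sub_zero] at key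
    linarith
  · rintro s ⟨⟨hs1, hs2⟩, hs3⟩
    rw [min_eq_left hR] at hs1
    have e1 : HasDerivAt (fun s : ℝ => |s|) 1 s := by
      have := hasDerivAt_abs hs1.ne'
      simpa [hs1] using this
    have e2 : HasDerivAt (fun s : ℝ => |s| ^ p) (1 * p * |s| ^ (p - 1)) s :=
      e1.rpow_const (Or.inr hp)
    have e3 := (hd s hs3).mul (e2.neg.exp)
    refine e3.congr_deriv ?_
    simp only [Pi.neg_apply]
    ring
  · exact hi.intervalIntegrable.sub (hc2.intervalIntegrable _ _)

lemma st_line (G G' : ℝ → ℝ) (S : Set ℝ) (hS : S.Countable) (p : ℝ) (hp : 1 ≤ p)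
    (hG : Continuous G) (hd : ∀ s, s ∉ S → HasDerivAt G (G' s) s)
    (h0 : G 0 = 0) (hpos : ∀ s, 0 ≤ s → 0 ≤ G s) (hneg : ∀ s, s ≤ 0 → G s ≤ 0) :
    0 ≤ ∫ s, G' s * Real.exp (-|s| ^ p) := by
  by_cases hi : Integrable (fun s => G' s * Real.exp (-|s| ^ p))
  swap
  · rw [integral_undef hi]
  have ht := intervalIntegral_tendsto_integral hi Filter.tendsto_neg_atTop_atBot Filter.tendsto_id
  refine ge_of_tendsto ht ?_
  filter_upwards [Filter.eventually_ge_atTop 0] with R hR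
  have hA := st_half G G' S hS p hp hG hd hi h0 hpos R hR
  have hi' : Integrable (fun s => G' (-s) * Real.exp (-|s| ^ p)) := by
    simpa using hi.comp_neg
  have hB := st_half (fun s => -G (-s)) (fun s => G' (-s)) (Set.image Neg.neg S) (hS.image _) p hp
    (hG.comp continuous_neg).neg (by
      intro s hs
      have : -s ∉ S := fun h => hs ⟨-s, h, by simp⟩
      have h1 := (hd (-s) this).comp s (hasDerivAt_neg s)
      refine h1.neg.congr_deriv (by ring)) hi' (by simp [h0])
      (fun s hs => by have := hneg (-s) (by linarith); linarith) R hR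
  have hB' : ∫ s in (-R)..0, G' s * Real.exp (-|s| ^ p)
      = ∫ s in (0 : ℝ)..R, G' (-s) * Real.exp (-|s| ^ p) := by
    have := intervalIntegral.integral_comp_neg (a := 0) (b := R)
      (fun s => G' s * Real.exp (-|s| ^ p))
    simp only [abs_neg, neg_zero] at this
    exact this.symm
  rw [← intervalIntegral.integral_add_adjacent_intervals (b := 0) hi.intervalIntegrable
    hi.intervalIntegrable, hB']
  exact add_nonneg hB hA

lemma st_dabs (h : ℝ → ℝ) (h' s : ℝ) (k : ℕ) (hh : HasDerivAt h h' s) (h0 : h s ≠ 0) :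
    HasDerivAt (fun s => |h s| ^ k) (|h s| ^ k * (k * h' / h s)) s := by
  have h1 : HasDerivAt (fun s => |h s|) (SignType.sign (h s) * h') s :=
    (hasDerivAt_abs h0).comp s hh
  refine (h1.pow k).congr_deriv ?_
  rcases k with _ | k
  · simp
  · simp only [Nat.add_sub_cancel, pow_succ]
    have : |h s| / h s = SignType.sign (h s) := by
      rw [div_eq_iff h0]
      exact (sign_mul_self (h s)).symm
    rw [← this]
    ring

lemma st_dprod {ι : Type*} (T : Finset ι) (g : ι → ℝ → ℝ) (r : ι → ℝ) (s : ℝ)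
    (h : ∀ j ∈ T, HasDerivAt (g j) (g j s * r j) s) :
    HasDerivAt (fun s => ∏ j ∈ T, g j s) ((∏ j ∈ T, g j s) * ∑ j ∈ T, r j) s := by
  classical
  induction T using Finset.induction_on with
  | empty => simpa using hasDerivAt_const s (1 : ℝ)
  | insert a T ha ih =>
    have h1 := h a (Finset.mem_insert_self a T)
    have h2 := ih (fun j hj => h j (Finset.mem_insert_of_mem hj))
    simp only [Finset.prod_insert ha, Finset.sum_insert ha]
    refine (h1.mul h2).congr_deriv ?_
    ring

lemma st_int1 (K : ℕ) (p : ℝ) (hp : 1 ≤ p) :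
    Integrable (fun s : ℝ => (1 + |s|) ^ K * Real.exp (-|s| ^ p)) := by
  have hcw : Continuous (fun s : ℝ => (1 + |s|) ^ K * Real.exp (-|s| ^ p)) := by
    refine Continuous.mul (by fun_prop) (Real.continuous_exp.comp (Continuous.neg ?_))
    exact continuous_abs.rpow_const (fun x => Or.inr (by linarith))
  refine (integrable_inv_one_add_sq.const_mul
    ((Nat.factorial (K + 2) : ℝ) * Real.exp 2)).mono' hcw.aestronglyMeasurable ?_
  refine Filter.Eventually.of_forall (fun s => ?_)
  have hs := abs_nonneg s
  rw [Real.norm_of_nonneg (by positivity)]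
  have h1 : |s| - 1 ≤ |s| ^ p := by
    by_cases h : 1 ≤ |s|
    · have := Real.self_le_rpow_of_one_le h hp
      linarith
    · have : 0 ≤ |s| ^ p := by positivity
      linarith
  have h2 : Real.exp (-|s| ^ p) ≤ Real.exp (1 - |s|) := Real.exp_le_exp.2 (by linarith)
  have h3 := Real.pow_div_factorial_le_exp (1 + |s|) (by positivity) (K + 2)
  rw [div_le_iff₀ (by positivity)] at h3
  have h4 : Real.exp (1 + |s|) * Real.exp (1 - |s|) = Real.exp 2 := by
    rw [← Real.exp_add]; norm_num
  rw [← div_eq_mul_inv, le_div_iff₀ (by positivity)]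
  have h5 : 1 + s ^ 2 ≤ (1 + |s|) ^ 2 := by
    have := sq_abs s
    nlinarith
  calc (1 + |s|) ^ K * Real.exp (-|s| ^ p) * (1 + s ^ 2)
      ≤ (1 + |s|) ^ K * Real.exp (1 - |s|) * (1 + |s|) ^ 2 := by gcongr
    _ = (1 + |s|) ^ (K + 2) * Real.exp (1 - |s|) := by ring
    _ ≤ (Real.exp (1 + |s|) * (Nat.factorial (K + 2) : ℝ)) * Real.exp (1 - |s|) := by gcongr
    _ = (Nat.factorial (K + 2) : ℝ) * (Real.exp (1 + |s|) * Real.exp (1 - |s|)) := by ring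
    _ = _ := by rw [h4]

/-! ### Measurable functions of polynomial growth -/

/-- Measurable functions of polynomial growth. -/
def StGr {n : ℕ} (g : (Fin n → ℝ) → ℝ) : Prop :=
  Measurable g ∧ ∃ (C : ℝ) (K : ℕ), 0 ≤ C ∧ ∀ x, |g x| ≤ C * (∏ i, (1 + |x i|)) ^ K

lemma st_one_le {n : ℕ} (x : Fin n → ℝ) : 1 ≤ ∏ i, (1 + |x i|) := by
  refine Finset.prod_induction (fun i => 1 + |x i|) (fun r => 1 ≤ r) ?_ le_rfl ?_
  · intro a b ha hb
    nlinarith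
  · intro i _
    linarith [abs_nonneg (x i)]

lemma StGr.const {n : ℕ} (c : ℝ) : StGr (fun _ : Fin n → ℝ => c) :=
  ⟨measurable_const, |c|, 0, abs_nonneg c, fun x => by simp⟩

lemma StGr.coord {n : ℕ} (i : Fin n) : StGr (fun x : Fin n → ℝ => x i) := by
  refine ⟨measurable_pi_apply i, 1, 1, zero_le_one, fun x => ?_⟩
  rw [pow_one, one_mul]
  have : (1 + |x i|) ≤ ∏ i, (1 + |x i|) := by
    rw [← Finset.mul_prod_erase _ _ (Finset.mem_univ i)]
    have h0 := abs_nonneg (x i)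
    have h1 : 1 ≤ ∏ j ∈ Finset.univ.erase i, (1 + |x j|) := by
      refine Finset.prod_induction (fun i => 1 + |x i|) (fun r => 1 ≤ r) ?_ le_rfl ?_
      · intro a b ha hb
        nlinarith
      · intro i _
        linarith [abs_nonneg (x i)]
    nlinarith
  linarith

lemma StGr.mul {n : ℕ} {f g : (Fin n → ℝ) → ℝ} (hf : StGr f) (hg : StGr g) :
    StGr (fun x => f x * g x) := by
  obtain ⟨mf, C, K, hC, h1⟩ := hf
  obtain ⟨mg, D, L, hD, h2⟩ := hg
  refine ⟨mf.mul mg, C * D, K + L, mul_nonneg hC hD, fun x => ?_⟩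
  rw [abs_mul, pow_add]
  have := st_one_le x
  calc |f x| * |g x| ≤ (C * (∏ i, (1 + |x i|)) ^ K) * (D * (∏ i, (1 + |x i|)) ^ L) := by
        gcongr
        · exact h1 x
        · exact h2 x
    _ = _ := by ring

lemma StGr.add {n : ℕ} {f g : (Fin n → ℝ) → ℝ} (hf : StGr f) (hg : StGr g) :
    StGr (fun x => f x + g x) := by
  obtain ⟨mf, C, K, hC, h1⟩ := hf
  obtain ⟨mg, D, L, hD, h2⟩ := hg
  refine ⟨mf.add mg, C + D, K + L, add_nonneg hC hD, fun x => ?_⟩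
  have h3 := st_one_le x
  have h4 : (∏ i, (1 + |x i|)) ^ K ≤ (∏ i, (1 + |x i|)) ^ (K + L) :=
    pow_le_pow_right₀ h3 (by omega)
  have h5 : (∏ i, (1 + |x i|)) ^ L ≤ (∏ i, (1 + |x i|)) ^ (K + L) :=
    pow_le_pow_right₀ h3 (by omega)
  calc |f x + g x| ≤ |f x| + |g x| := abs_add_le _ _
    _ ≤ C * (∏ i, (1 + |x i|)) ^ K + D * (∏ i, (1 + |x i|)) ^ L := add_le_add (h1 x) (h2 x)
    _ ≤ C * (∏ i, (1 + |x i|)) ^ (K + L) + D * (∏ i, (1 + |x i|)) ^ (K + L) := by gcongr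
    _ = _ := by ring

lemma StGr.sub {n : ℕ} {f g : (Fin n → ℝ) → ℝ} (hf : StGr f) (hg : StGr g) :
    StGr (fun x => f x - g x) := by
  have := hf.add ((StGr.const (-1)).mul hg)
  simpa [sub_eq_add_neg] using this

lemma StGr.abs {n : ℕ} {f : (Fin n → ℝ) → ℝ} (hf : StGr f) : StGr (fun x => |f x|) := by
  obtain ⟨mf, C, K, hC, h1⟩ := hf
  exact ⟨mf.abs, C, K, hC, fun x => by rw [abs_abs]; exact h1 x⟩

lemma StGr.pow {n : ℕ} {f : (Fin n → ℝ) → ℝ} (hf : StGr f) (k : ℕ) :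
    StGr (fun x => f x ^ k) := by
  induction k with
  | zero => simpa using StGr.const 1
  | succ k ih => simpa [pow_succ] using ih.mul hf

lemma StGr.sum {n : ℕ} {ι : Type*} (T : Finset ι) {f : ι → (Fin n → ℝ) → ℝ}
    (hf : ∀ j ∈ T, StGr (f j)) : StGr (fun x => ∑ j ∈ T, f j x) := by
  classical
  induction T using Finset.induction_on with
  | empty => simpa using StGr.const 0
  | insert a T ha ih =>
    simp only [Finset.sum_insert ha]
    exact (hf a (Finset.mem_insert_self a T)).add
      (ih (fun j hj => hf j (Finset.mem_insert_of_mem hj)))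

lemma StGr.prod {n : ℕ} {ι : Type*} (T : Finset ι) {f : ι → (Fin n → ℝ) → ℝ}
    (hf : ∀ j ∈ T, StGr (f j)) : StGr (fun x => ∏ j ∈ T, f j x) := by
  classical
  induction T using Finset.induction_on with
  | empty => simpa using StGr.const 1
  | insert a T ha ih =>
    simp only [Finset.prod_insert ha]
    exact (hf a (Finset.mem_insert_self a T)).mul
      (ih (fun j hj => hf j (Finset.mem_insert_of_mem hj)))

lemma StGr.absdiv {n : ℕ} {f : (Fin n → ℝ) → ℝ} (hf : StGr f) (k : ℕ) :
    StGr (fun x => |f x| ^ (k + 1) / f x) := by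
  obtain ⟨mg, D, L, hD, h2⟩ := hf.abs.pow k
  refine ⟨(hf.abs.pow (k + 1)).1.div hf.1, D, L, hD, fun x => le_trans ?_ (h2 x)⟩
  by_cases h : f x = 0
  · simp [h]
  · rw [abs_div, abs_pow, abs_abs, abs_pow, abs_abs, pow_succ, mul_div_assoc,
      div_self (abs_ne_zero.2 h), mul_one]

lemma StGr.integrable {n : ℕ} {g : (Fin n → ℝ) → ℝ} (hg : StGr g) (p : ℝ) (hp : 1 ≤ p) :
    Integrable (fun x : Fin n → ℝ => g x * Real.exp (-∑ i, |x i| ^ p)) := by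
  obtain ⟨mg, C, K, hC, h⟩ := hg
  have h1 : Integrable (fun x : Fin n → ℝ => ∏ i, ((1 + |x i|) ^ K * Real.exp (-|x i| ^ p))) :=
    Integrable.fintype_prod (f := fun _ s => (1 + |s|) ^ K * Real.exp (-|s| ^ p))
      (fun _ => st_int1 K p hp)
  refine (h1.const_mul C).mono' ?_ ?_
  · refine (mg.mul ?_).aestronglyMeasurable
    refine Real.measurable_exp.comp (Measurable.neg ?_)
    refine Finset.measurable_sum _ (fun i _ => ?_)
    exact ((measurable_pi_apply i).abs).pow_const p
  · refine Filter.Eventually.of_forall (fun x => ?_)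
    rw [norm_mul, Real.norm_eq_abs, Real.norm_of_nonneg (Real.exp_pos _).le]
    rw [Finset.prod_mul_distrib, Finset.prod_pow, ← Real.exp_sum, Finset.sum_neg_distrib,
      ← mul_assoc]
    gcongr
    exact h x

/-! ### The density -/

lemma st_fabc_nonneg (n b c : ℕ) (x : Fin n → ℝ) : 0 ≤ fabc n 2 b c x := by
  unfold fabc
  refine mul_nonneg (Finset.prod_nonneg fun i _ => Finset.prod_nonneg fun j _ => ?_)
    (Finset.prod_nonneg fun i _ => by positivity)
  split_ifs <;> positivity

lemma st_fabc_cons (m b c : ℕ) (s : ℝ) (y : Fin m → ℝ) :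
    fabc (m + 1) 2 b c (Fin.cons s y) =
      |s| ^ c * (∏ j, |s ^ 2 - y j ^ 2| ^ b) * fabc m 2 b c y := by
  unfold fabc
  simp only [Fin.prod_univ_succ, Fin.cons_zero, Fin.cons_succ, Fin.succ_lt_succ_iff,
    Fin.succ_pos, Fin.not_lt_zero, if_true, if_false, one_mul]
  ring

lemma st_fabc_gr_comp {n m b c : ℕ} (φ : Fin m → Fin n) :
    StGr (fun x : Fin n → ℝ => fabc m 2 b c (fun k => x (φ k))) := by
  unfold fabc
  refine StGr.mul (StGr.prod _ fun i _ => StGr.prod _ fun j _ => ?_)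
    (StGr.prod _ fun i _ => (StGr.coord _).abs.pow c)
  by_cases h : i < j
  · simp only [h, if_true]
    exact (((StGr.coord _).pow 2).sub ((StGr.coord _).pow 2)).abs.pow b
  · simp only [h, if_false]
    exact StGr.const 1

lemma st_fabc_gr {n b c : ℕ} : StGr (fun x : Fin n → ℝ => fabc n 2 b c x) :=
  st_fabc_gr_comp id

lemma st_fabc_div_gr (m b c : ℕ) (j : Fin (m + 1)) :
    StGr (fun x : Fin (m + 1) → ℝ => fabc (m + 1) 2 (b + 1) c x / (x 0 ^ 2 - x j ^ 2)) := by
  refine Fin.cases ?_ (fun k => ?_) j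
  · simpa using StGr.const 0
  · have key : ∀ x : Fin (m + 1) → ℝ,
        fabc (m + 1) 2 (b + 1) c x / (x 0 ^ 2 - x k.succ ^ 2) =
        |x 0| ^ c * ((|x 0 ^ 2 - x k.succ ^ 2| ^ (b + 1) / (x 0 ^ 2 - x k.succ ^ 2)) *
          ∏ l ∈ Finset.univ.erase k, |x 0 ^ 2 - x l.succ ^ 2| ^ (b + 1)) *
          fabc m 2 (b + 1) c (fun l => x l.succ) := by
      intro x
      have h1 : x = Fin.cons (x 0) (fun l => x l.succ) := (Fin.cons_self_tail x).symm
      conv_lhs => rw [h1, st_fabc_cons, ← Finset.mul_prod_erase _ _ (Finset.mem_univ k)]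
      simp only [Fin.cons_zero, Fin.cons_succ]
      ring
    simp only [key]
    have hd : ∀ l : Fin m, StGr (fun x : Fin (m + 1) → ℝ => x 0 ^ 2 - x l.succ ^ 2) :=
      fun l => ((StGr.coord _).pow 2).sub ((StGr.coord _).pow 2)
    refine (((StGr.coord 0).abs.pow c).mul (((hd k).absdiv b).mul
      (StGr.prod _ fun l _ => (hd l).abs.pow _))).mul (st_fabc_gr_comp _)

lemma st_pair_sq {n : ℕ} (g : Fin n → Fin n → ℝ) (hg : ∀ i j, g i j = g j i) :
    (∏ i, ∏ j, if i < j then g i j else 1) ^ 2 = ∏ i, ∏ j, if i = j then 1 else g i j := by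
  have h1 : (∏ i, ∏ j, if i < j then g i j else 1) = ∏ i, ∏ j, if j < i then g i j else 1 := by
    rw [Finset.prod_comm]
    simp only [hg]
  rw [sq]
  nth_rewrite 2 [h1]
  simp only [← Finset.prod_mul_distrib]
  refine Finset.prod_congr rfl fun i _ => Finset.prod_congr rfl fun j _ => ?_
  rcases lt_trichotomy i j with h | h | h
  · simp [h, h.ne, not_lt.2 h.le]
  · simp [h]
  · simp [h, h.ne', not_lt.2 h.le]

lemma st_fabc_perm (n b c : ℕ) (σ : Equiv.Perm (Fin n)) (x : Fin n → ℝ) :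
    fabc n 2 b c (fun i => x (σ i)) = fabc n 2 b c x := by
  unfold fabc
  congr 1
  · have hnn : ∀ y : Fin n → ℝ,
        0 ≤ ∏ i, ∏ j, if i < j then |y i ^ 2 - y j ^ 2| ^ b else 1 := by
      intro y
      refine Finset.prod_nonneg fun i _ => Finset.prod_nonneg fun j _ => ?_
      split_ifs <;> positivity
    refine (sq_eq_sq₀ (hnn _) (hnn _)).1 ?_
    rw [st_pair_sq (fun i j => |x (σ i) ^ 2 - x (σ j) ^ 2| ^ b) (fun i j => by rw [abs_sub_comm]),
      st_pair_sq (fun i j => |x i ^ 2 - x j ^ 2| ^ b) (fun i j => by rw [abs_sub_comm])]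
    rw [← Equiv.prod_comp σ (fun i => ∏ j, if i = j then 1 else |x i ^ 2 - x j ^ 2| ^ b)]
    refine Finset.prod_congr rfl fun i _ => ?_
    rw [← Equiv.prod_comp σ (fun j => if σ i = j then 1 else |x (σ i) ^ 2 - x j ^ 2| ^ b)]
    simp [σ.injective.eq_iff]
  · exact Equiv.prod_comp σ (fun i => |x i| ^ c)

lemma st_perm_eq {n : ℕ} (σ : Equiv.Perm (Fin n)) :
    (fun (x : Fin n → ℝ) (i : Fin n) => x (σ i)) =
      MeasurableEquiv.piCongrLeft (fun _ : Fin n => ℝ) σ.symm := by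
  funext x i
  have := Equiv.piCongrLeft_apply_apply (fun _ : Fin n => ℝ) σ.symm x (σ i)
  simp only [Equiv.symm_apply_apply] at this
  exact this.symm

lemma st_mp_perm {n : ℕ} (σ : Equiv.Perm (Fin n)) :
    MeasurePreserving (fun (x : Fin n → ℝ) (i : Fin n) => x (σ i)) := by
  rw [st_perm_eq]
  exact volume_measurePreserving_piCongrLeft (fun _ : Fin n => ℝ) σ.symm

lemma st_emb_perm {n : ℕ} (σ : Equiv.Perm (Fin n)) :
    MeasurableEmbedding (fun (x : Fin n → ℝ) (i : Fin n) => x (σ i)) := by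
  rw [st_perm_eq]
  exact (MeasurableEquiv.piCongrLeft (fun _ : Fin n => ℝ) σ.symm).measurableEmbedding

/-! ### The divergence terms -/

/-- The polynomial-like factor in the `i`-th divergence term. -/
noncomputable def StPsi (n b : ℕ) (i : Fin n) (x : Fin n → ℝ) : ℝ :=
  ((b : ℝ) + 1) * (x i ^ 2 - 2 / n * ∑ j, x j ^ 2) ^ 2
    + 4 * (1 - 2 / (n : ℝ)) * x i ^ 2 * (x i ^ 2 - 2 / n * ∑ j, x j ^ 2)
    + ∑ j, ((b : ℝ) + 1) *
      (2 * x i ^ 2 * (x i ^ 2 - 2 / n * ∑ j, x j ^ 2) ^ 2 / (x i ^ 2 - x j ^ 2))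

/-- The `i`-th divergence term. -/
noncomputable def StPhi (n b : ℕ) (p : ℝ) (i : Fin n) (x : Fin n → ℝ) : ℝ :=
  StPsi n b i x * fabc n 2 (b + 1) b x * Real.exp (-∑ i, |x i| ^ p)

lemma st_phi_perm (n b : ℕ) (p : ℝ) (i : Fin n) (σ : Equiv.Perm (Fin n)) (x : Fin n → ℝ) :
    StPhi n b p i (fun k => x (σ k)) = StPhi n b p (σ i) x := by
  unfold StPhi StPsi
  rw [st_fabc_perm, Equiv.sum_comp σ (fun k => |x k| ^ p), Equiv.sum_comp σ (fun k => x k ^ 2)]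
  rw [Equiv.sum_comp σ (fun j => ((b : ℝ) + 1) *
      (2 * x (σ i) ^ 2 * (x (σ i) ^ 2 - 2 / n * ∑ j, x j ^ 2) ^ 2 / (x (σ i) ^ 2 - x j ^ 2)))]

lemma st_phi_int0 (m b : ℕ) (p : ℝ) (hp : 1 ≤ p) : Integrable (StPhi (m + 1) b p 0) := by
  unfold StPhi
  refine StGr.integrable (g := fun x => StPsi (m + 1) b 0 x * fabc (m + 1) 2 (b + 1) b x) ?_ p hp
  have key : ∀ x : Fin (m + 1) → ℝ, StPsi (m + 1) b 0 x * fabc (m + 1) 2 (b + 1) b x =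
      (((b : ℝ) + 1) * (x 0 ^ 2 - 2 / ((m + 1 : ℕ) : ℝ) * ∑ j, x j ^ 2) ^ 2
      + 4 * (1 - 2 / ((m + 1 : ℕ) : ℝ)) * x 0 ^ 2 *
        (x 0 ^ 2 - 2 / ((m + 1 : ℕ) : ℝ) * ∑ j, x j ^ 2)) * fabc (m + 1) 2 (b + 1) b x
      + ∑ j, ((b : ℝ) + 1) * (2 * x 0 ^ 2 *
        (x 0 ^ 2 - 2 / ((m + 1 : ℕ) : ℝ) * ∑ j, x j ^ 2) ^ 2) *
        (fabc (m + 1) 2 (b + 1) b x / (x 0 ^ 2 - x j ^ 2)) := by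
    intro x
    unfold StPsi
    rw [add_mul, Finset.sum_mul]
    congr 1
    refine Finset.sum_congr rfl fun j _ => ?_
    ring
  simp only [key]
  have hx : StGr (fun x : Fin (m + 1) → ℝ => x 0 ^ 2) := (StGr.coord 0).pow 2
  have hu : StGr (fun x : Fin (m + 1) → ℝ => x 0 ^ 2 - 2 / ((m + 1 : ℕ) : ℝ) * ∑ j, x j ^ 2) :=
    hx.sub ((StGr.const _).mul (StGr.sum _ fun j _ => (StGr.coord j).pow 2))
  refine ((((StGr.const _).mul (hu.pow 2)).add (((StGr.const _).mul hx).mul hu)).mul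
    st_fabc_gr).add (StGr.sum _ fun j _ => ?_)
  exact ((StGr.const _).mul (((StGr.const 2).mul hx).mul (hu.pow 2))).mul (st_fabc_div_gr m b b j)

lemma st_phi_line (m b : ℕ) (p : ℝ) (hp : 1 ≤ p) (y : Fin m → ℝ) :
    0 ≤ ∫ s, StPhi (m + 1) b p 0 (Fin.cons s y) := by
  set κ : ℝ := 2 / ((m + 1 : ℕ) : ℝ) with hκ
  set T : ℝ := ∑ j, y j ^ 2 with hT
  set H : ℝ → ℝ := fun s => |s| ^ b * ∏ j, |s ^ 2 - y j ^ 2| ^ (b + 1) with hH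
  set G' : ℝ → ℝ := fun s => (((b : ℝ) + 1) * (s ^ 2 - κ * (s ^ 2 + T)) ^ 2
    + 4 * (1 - κ) * s ^ 2 * (s ^ 2 - κ * (s ^ 2 + T))
    + ∑ j, ((b : ℝ) + 1) *
      (2 * s ^ 2 * (s ^ 2 - κ * (s ^ 2 + T)) ^ 2 / (s ^ 2 - y j ^ 2))) * H s with hG'
  have e : ∀ s, StPhi (m + 1) b p 0 (Fin.cons s y) =
      (fabc m 2 (b + 1) b y * Real.exp (-∑ i, |y i| ^ p)) * (G' s * Real.exp (-|s| ^ p)) := by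
    intro s
    unfold StPhi StPsi
    rw [st_fabc_cons]
    simp only [Fin.sum_univ_succ, Fin.cons_zero, Fin.cons_succ, sub_self, div_zero, mul_zero,
      zero_add]
    rw [← hT, ← hκ, neg_add, Real.exp_add]
    simp only [hG', hH]
    ring
  simp only [e]
  rw [integral_const_mul]
  refine mul_nonneg (mul_nonneg (st_fabc_nonneg _ _ _ _) (Real.exp_pos _).le) ?_
  have hHn : ∀ s, 0 ≤ H s := fun s =>
    mul_nonneg (by positivity) (Finset.prod_nonneg fun j _ => by positivity)
  refine st_line (fun s => s * (s ^ 2 - κ * (s ^ 2 + T)) ^ 2 * H s) G'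
    ({0} ∪ (Set.range y ∪ Set.range (fun j => - y j))) ?_ p hp ?_ ?_ ?_ ?_ ?_
  · exact (Set.countable_singleton 0).union
      ((Set.countable_range _).union (Set.countable_range _))
  · simp only [hH]
    fun_prop
  · intro s hs
    simp only [Set.mem_union, Set.mem_singleton_iff, Set.mem_range, not_or, not_exists] at hs
    obtain ⟨hs0, hs1, hs2⟩ := hs
    have hne : ∀ j, s ^ 2 - y j ^ 2 ≠ 0 := by
      intro j h
      have h' : (s - y j) * (s + y j) = 0 := by linarith [h, sq_sub_sq s (y j)]
      rcases mul_eq_zero.1 h' with h1 | h1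
      · exact hs1 j (by linarith)
      · exact hs2 j (by linarith)
    have d1 : HasDerivAt (fun s : ℝ => |s| ^ b) (|s| ^ b * (b * 1 / s)) s :=
      st_dabs (fun s => s) 1 s b (hasDerivAt_id s) hs0
    have d2 : HasDerivAt (fun s : ℝ => ∏ j, |s ^ 2 - y j ^ 2| ^ (b + 1))
        ((∏ j, |s ^ 2 - y j ^ 2| ^ (b + 1)) *
          ∑ j, (((b + 1 : ℕ) : ℝ) * (2 * s) / (s ^ 2 - y j ^ 2))) s := by
      refine st_dprod Finset.univ (fun j s => |s ^ 2 - y j ^ 2| ^ (b + 1)) _ s fun j _ => ?_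
      refine st_dabs (fun s => s ^ 2 - y j ^ 2) (2 * s) s (b + 1) ?_ (hne j)
      simpa using (hasDerivAt_pow 2 s).sub_const (y j ^ 2)
    have d3 : HasDerivAt (fun s : ℝ => s ^ 2 - κ * (s ^ 2 + T)) (2 * s - κ * (2 * s)) s := by
      have h2 : HasDerivAt (fun s : ℝ => s ^ 2) (2 * s) s := by simpa using hasDerivAt_pow 2 s
      exact h2.sub ((h2.add_const T).const_mul κ)
    have d4 := ((hasDerivAt_id s).mul (d3.pow 2)).mul (d1.mul d2)
    refine d4.congr_deriv ?_
    have hsum : ∑ j, ((b : ℝ) + 1) *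
        (2 * s ^ 2 * (s ^ 2 - κ * (s ^ 2 + T)) ^ 2 / (s ^ 2 - y j ^ 2)) =
        s * (s ^ 2 - κ * (s ^ 2 + T)) ^ 2 *
          ∑ j, (((b + 1 : ℕ) : ℝ) * (2 * s) / (s ^ 2 - y j ^ 2)) := by
      rw [Finset.mul_sum]
      refine Finset.sum_congr rfl fun j _ => ?_
      push_cast
      ring
    simp only [hG', hH, hsum]
    simp only [Pi.mul_apply, Pi.pow_apply, id]
    push_cast
    field_simp
    ring
  · simp
  · intro s hs
    exact mul_nonneg (mul_nonneg hs (sq_nonneg _)) (hHn s)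
  · intro s hs
    exact mul_nonpos_of_nonpos_of_nonneg (mul_nonpos_of_nonpos_of_nonneg hs (sq_nonneg _)) (hHn s)

lemma st_fubini (m : ℕ) (F : (Fin (m + 1) → ℝ) → ℝ) (hF : Integrable F)
    (h : ∀ y : Fin m → ℝ, 0 ≤ ∫ s, F (Fin.cons s y)) : 0 ≤ ∫ x, F x := by
  have hv := (volume_preserving_piFinSuccAbove (fun _ : Fin (m + 1) => ℝ) 0).symm
  rw [← hv.integral_comp' F]
  have hF' : Integrable (fun z => F ((MeasurableEquiv.piFinSuccAbove
      (fun _ : Fin (m + 1) => ℝ) 0).symm z)) :=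
    (hv.integrable_comp_emb (MeasurableEquiv.measurableEmbedding _)).2 hF
  rw [Measure.volume_eq_prod] at hF' ⊢
  rw [integral_prod_symm _ hF']
  refine integral_nonneg fun y => ?_
  refine le_of_le_of_eq (h y) ?_
  refine integral_congr_ae (Filter.Eventually.of_forall fun s => ?_)
  simp [MeasurableEquiv.piFinSuccAbove_symm_apply, Fin.insertNthEquiv]

lemma st_phi (n b : ℕ) (p : ℝ) (hp : 1 ≤ p) (i : Fin n) :
    Integrable (StPhi n b p i) ∧ 0 ≤ ∫ x, StPhi n b p i x := by
  rcases n with _ | m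
  · exact i.elim0
  have h0 := st_phi_int0 m b p hp
  have h1 := st_fubini m _ h0 (st_phi_line m b p hp)
  have e : StPhi (m + 1) b p i =
      StPhi (m + 1) b p 0 ∘ (fun x k => x (Equiv.swap 0 i k)) := by
    funext x
    simp only [Function.comp]
    rw [st_phi_perm, Equiv.swap_apply_left]
  rw [e]
  refine ⟨((st_mp_perm _).integrable_comp_emb (st_emb_perm _)).2 h0, ?_⟩
  simp only [Function.comp]
  rw [(st_mp_perm _).integral_comp (st_emb_perm _) (StPhi (m + 1) b p 0)]
  exact h1

lemma st_psi_sum (n b : ℕ) (hn : 1 ≤ n) (x : Fin n → ℝ) (hx : ∀ i j, i ≠ j → x i ^ 2 ≠ x j ^ 2) :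
    ∑ i, StPsi n b i x =
      (2 * ((b : ℝ) + 1) * n + 4 - 2 * (b + 1) - 8 / n) * ∑ i, x i ^ 4
      - (3 * ((b : ℝ) + 1) + 4 * (2 - (b + 1)) / n - 16 / n ^ 2) * (∑ i, x i ^ 2) ^ 2 := by
  have hn0 : (n : ℝ) ≠ 0 := by positivity
  set S := ∑ j, x j ^ 2 with hS
  set Q := ∑ j, x j ^ 4 with hQ
  set κ : ℝ := 2 / n with hκ
  have hQ' : ∑ j, (x j ^ 2) ^ 2 = Q := by
    rw [hQ]; exact Finset.sum_congr rfl fun j _ => by ring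
  let P : ℝ → ℝ → ℝ := fun u v => u ^ 2 + u * v + v ^ 2 - 2 * (κ * S) * (u + v) + (κ * S) ^ 2
  have hA : ∑ i, ∑ j, (2 * x i ^ 2 * (x i ^ 2 - κ * S) ^ 2 / (x i ^ 2 - x j ^ 2)) =
      ∑ i, ∑ j, (P (x i ^ 2) (x j ^ 2) - if i = j then P (x i ^ 2) (x i ^ 2) else 0) := by
    have h1 : ∑ i, ∑ j, (2 * x i ^ 2 * (x i ^ 2 - κ * S) ^ 2 / (x i ^ 2 - x j ^ 2)) =
        ∑ i, ∑ j, (x i ^ 2 * (x i ^ 2 - κ * S) ^ 2 / (x i ^ 2 - x j ^ 2)) +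
        ∑ i, ∑ j, (x j ^ 2 * (x j ^ 2 - κ * S) ^ 2 / (x j ^ 2 - x i ^ 2)) := by
      rw [Finset.sum_comm (f := fun i j => x j ^ 2 * (x j ^ 2 - κ * S) ^ 2 / (x j ^ 2 - x i ^ 2)),
        ← Finset.sum_add_distrib]
      refine Finset.sum_congr rfl fun i _ => ?_
      rw [← Finset.sum_add_distrib]
      refine Finset.sum_congr rfl fun j _ => ?_
      ring
    rw [h1, ← Finset.sum_add_distrib]
    refine Finset.sum_congr rfl fun i _ => ?_
    rw [← Finset.sum_add_distrib]
    refine Finset.sum_congr rfl fun j _ => ?_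
    by_cases h : i = j
    · subst h; simp
    · have h2 : x i ^ 2 - x j ^ 2 ≠ 0 := sub_ne_zero.2 (hx i j h)
      have h3 : x j ^ 2 - x i ^ 2 = -(x i ^ 2 - x j ^ 2) := by ring
      rw [h3, if_neg h, div_neg, ← sub_eq_add_neg, ← sub_div, div_eq_iff h2]
      simp only [P]
      ring
  have hB : ∑ i, ∑ j, (P (x i ^ 2) (x j ^ 2) - if i = j then P (x i ^ 2) (x i ^ 2) else 0) =
      2 * n * Q + S ^ 2 - 4 * (κ * S) * n * S + n ^ 2 * (κ * S) ^ 2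
      - (3 * Q - 4 * (κ * S) * S + n * (κ * S) ^ 2) := by
    simp only [Finset.sum_sub_distrib, Finset.sum_ite_eq, Finset.mem_univ, if_true]
    simp only [P, Finset.sum_add_distrib, Finset.sum_sub_distrib, ← Finset.mul_sum,
      ← Finset.sum_mul, hQ', ← hS, Finset.sum_const, Finset.card_univ, Fintype.card_fin,
      nsmul_eq_mul]
    have h5 : ∑ i, x i ^ 2 * x i ^ 2 = Q := by
      rw [hQ]; exact Finset.sum_congr rfl fun j _ => by ring
    rw [h5]
    ring
  have hC : ∑ i, (x i ^ 2 - κ * S) ^ 2 = Q - 2 * (κ * S) * S + n * (κ * S) ^ 2 := by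
    have : ∀ i, (x i ^ 2 - κ * S) ^ 2 = x i ^ 4 - 2 * (κ * S) * x i ^ 2 + (κ * S) ^ 2 :=
      fun i => by ring
    simp only [this, Finset.sum_add_distrib, Finset.sum_sub_distrib, ← Finset.mul_sum,
      ← hS, ← hQ, Finset.sum_const, Finset.card_univ, Fintype.card_fin, nsmul_eq_mul]
  have hD : ∑ i, x i ^ 2 * (x i ^ 2 - κ * S) = Q - κ * S * S := by
    have : ∀ i, x i ^ 2 * (x i ^ 2 - κ * S) = x i ^ 4 - (κ * S) * x i ^ 2 := fun i => by ring
    simp only [this, Finset.sum_sub_distrib, ← Finset.mul_sum, ← hS, ← hQ]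
  unfold StPsi
  simp only [← hS, ← hκ, Finset.sum_add_distrib, ← Finset.mul_sum, mul_assoc (4 * (1 - κ))]
  rw [hA, hB, hC, hD, hκ]
  field_simp
  ring

lemma st_phi_sum (n b : ℕ) (hn : 1 ≤ n) (p : ℝ) (x : Fin n → ℝ) :
    ∑ i, StPhi n b p i x =
      ((2 * ((b : ℝ) + 1) * n + 4 - 2 * (b + 1) - 8 / n) * ∑ i, x i ^ 4
      - (3 * ((b : ℝ) + 1) + 4 * (2 - (b + 1)) / n - 16 / n ^ 2) * (∑ i, x i ^ 2) ^ 2)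
      * fabc n 2 (b + 1) b x * Real.exp (-∑ i, |x i| ^ p) := by
  unfold StPhi
  rw [← Finset.sum_mul, ← Finset.sum_mul]
  by_cases h : ∀ i j, i ≠ j → x i ^ 2 ≠ x j ^ 2
  · rw [st_psi_sum n b hn x h]
  · push Not at h
    obtain ⟨i, j, hij, he⟩ := h
    have : fabc n 2 (b + 1) b x = 0 := by
      unfold fabc
      refine mul_eq_zero_of_left ?_ _
      rcases lt_or_gt_of_ne hij with hlt | hlt
      · refine Finset.prod_eq_zero (Finset.mem_univ i) (Finset.prod_eq_zero (Finset.mem_univ j) ?_)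
        simp [hlt, he]
      · refine Finset.prod_eq_zero (Finset.mem_univ j) (Finset.prod_eq_zero (Finset.mem_univ i) ?_)
        simp [hlt, he]
    simp [this]

/-! ### Assembly -/

lemma st_dens_int {n b : ℕ} {g : (Fin n → ℝ) → ℝ} (hg : StGr g) (p : ℝ) (hp : 1 ≤ p) :
    Integrable (fun x => g x * fabc n 2 (b + 1) b x * Real.exp (-∑ i, |x i| ^ p)) :=
  (hg.mul st_fabc_gr).integrable p hp

lemma st_coord_mp (n b k : ℕ) (p : ℝ) (i j : Fin n) :
    Mp n 2 (b + 1) b p (fun x => x i ^ k) = Mp n 2 (b + 1) b p (fun x => x j ^ k) := by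
  unfold Mp
  rw [← (st_mp_perm (Equiv.swap i j)).integral_comp (st_emb_perm _)]
  refine integral_congr_ae (Filter.Eventually.of_forall fun x => ?_)
  simp only [Equiv.swap_apply_left]
  rw [st_fabc_perm, Equiv.sum_comp (Equiv.swap i j) (fun k => |x k| ^ p)]

lemma st_sum_mp (n b k : ℕ) (p : ℝ) (hp : 1 ≤ p) (i : Fin n) :
    Mp n 2 (b + 1) b p (fun x => ∑ j, x j ^ k) = n * Mp n 2 (b + 1) b p (fun x => x i ^ k) := by
  have h1 : Mp n 2 (b + 1) b p (fun x => ∑ j, x j ^ k) =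
      ∑ j, Mp n 2 (b + 1) b p (fun x => x j ^ k) := by
    unfold Mp
    simp only [Finset.sum_mul]
    exact integral_finsetSum _ fun j _ => st_dens_int ((StGr.coord j).pow k) p hp
  rw [h1, Finset.sum_congr rfl fun j _ => st_coord_mp n b k p j i]
  simp

lemma st_main_ineq (n b : ℕ) (hn : 1 ≤ n) (p : ℝ) (hp : 1 ≤ p) :
    (3 * ((b : ℝ) + 1) + 4 * (2 - (b + 1)) / n - 16 / n ^ 2) *
      Mp n 2 (b + 1) b p (fun x => (∑ i, x i ^ 2) ^ 2) ≤
    (2 * ((b : ℝ) + 1) * n + 4 - 2 * (b + 1) - 8 / n) *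
      Mp n 2 (b + 1) b p (fun x => ∑ i, x i ^ 4) := by
  have h1 : 0 ≤ ∫ x, ∑ i, StPhi n b p i x := by
    rw [integral_finsetSum _ fun i _ => (st_phi n b p hp i).1]
    exact Finset.sum_nonneg fun i _ => (st_phi n b p hp i).2
  have i4 := st_dens_int (b := b) (StGr.sum (n := n) Finset.univ
    fun j _ => (StGr.coord j).pow 4) p hp
  have i2 := st_dens_int (b := b) ((StGr.sum (n := n) Finset.univ
    fun j _ => (StGr.coord j).pow 2).pow 2) p hp
  simp only [st_phi_sum n b hn p, sub_mul] at h1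
  simp only [mul_assoc _ _ (fabc _ _ _ _ _), mul_assoc _ _ (Real.exp _)] at h1 i4 i2
  unfold Mp
  simp only [mul_assoc _ _ (Real.exp _)]
  rw [← integral_const_mul, ← integral_const_mul]
  rw [← sub_nonneg, ← integral_sub (i4.const_mul _) (i2.const_mul _)]
  refine le_of_le_of_eq h1 (integral_congr_ae (Filter.Eventually.of_forall fun x => ?_))
  ring

lemma st_cs (n b : ℕ) (p : ℝ) (hp : 1 ≤ p) :
    (Mp n 2 (b + 1) b p (fun x => ∑ i, x i ^ 2)) ^ 2 ≤
      Mp n 2 (b + 1) b p (fun x => (∑ i, x i ^ 2) ^ 2) * Mp n 2 (b + 1) b p (fun _ => 1) := by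
  have g1 : StGr (fun x : Fin n → ℝ => ∑ i, x i ^ 2) :=
    StGr.sum Finset.univ fun j _ => (StGr.coord j).pow 2
  have j2 := st_dens_int (b := b) (g1.pow 2) p hp
  have j1 := st_dens_int (b := b) g1 p hp
  have j0 := st_dens_int (b := b) (StGr.const (n := n) 1) p hp
  have key : ∀ t : ℝ, 0 ≤ Mp n 2 (b + 1) b p (fun _ => 1) * (t * t)
      + (-2 * Mp n 2 (b + 1) b p (fun x => ∑ i, x i ^ 2)) * t
      + Mp n 2 (b + 1) b p (fun x => (∑ i, x i ^ 2) ^ 2) := by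
    intro t
    have h : 0 ≤ ∫ x : Fin n → ℝ, ((∑ i, x i ^ 2) - t) ^ 2 * fabc n 2 (b + 1) b x *
        Real.exp (-∑ i, |x i| ^ p) :=
      integral_nonneg fun x => mul_nonneg (mul_nonneg (sq_nonneg _) (st_fabc_nonneg _ _ _ _))
        (Real.exp_pos _).le
    refine le_of_le_of_eq h ?_
    unfold Mp
    beta_reduce
    rw [mul_comm _ (t * t), mul_right_comm (-2 : ℝ), ← integral_const_mul, ← integral_const_mul,
      ← integral_add (j0.const_mul _) (j1.const_mul _)]
    refine Eq.trans ?_ (integral_add ((j0.const_mul (t * t)).add (j1.const_mul (-2 * t))) j2)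
    refine integral_congr_ae (Filter.Eventually.of_forall fun x => ?_)
    simp only
    ring
  have := discrim_le_zero key
  unfold discrim at this
  nlinarith

lemma st_final (n b : ℕ) (hb : b ≤ 1) (ε : ℝ) (hε : 0 < ε) (h3 : 3 ≤ n) (hn : 11 / ε ≤ n)
    (p : ℝ) (hp : 1 ≤ p) (i : Fin n) :
    (3 / 2 - ε) * (Mp n 2 (b + 1) b p (fun x => x i ^ 2) / Mp n 2 (b + 1) b p (fun _ => 1)) ^ 2 ≤
      Mp n 2 (b + 1) b p (fun x => x i ^ 4) / Mp n 2 (b + 1) b p (fun _ => 1) := by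
  have hmain := st_main_ineq n b (by omega) p hp
  have hcs := st_cs n b p hp
  rw [st_sum_mp n b 2 p hp i] at hcs
  rw [st_sum_mp n b 4 p hp i] at hmain
  have nn : ∀ g : (Fin n → ℝ) → ℝ, (∀ x, 0 ≤ g x) → 0 ≤ Mp n 2 (b + 1) b p g := fun g hg =>
    integral_nonneg fun x => mul_nonneg (mul_nonneg (hg x) (st_fabc_nonneg _ _ _ _))
      (Real.exp_pos _).le
  have hZ := nn (fun _ => 1) (fun _ => zero_le_one)
  have hM4 := nn (fun x => x i ^ 4) (fun x => by positivity)
  have hB := nn (fun x => (∑ i, x i ^ 2) ^ 2) (fun x => by positivity)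
  set Z := Mp n 2 (b + 1) b p (fun _ => 1)
  set M2 := Mp n 2 (b + 1) b p (fun x => x i ^ 2)
  set M4 := Mp n 2 (b + 1) b p (fun x => x i ^ 4)
  set B := Mp n 2 (b + 1) b p (fun x => (∑ i, x i ^ 2) ^ 2)
  rcases hZ.eq_or_lt with h0 | hZ
  · rw [← h0]; simp
  have hN3 : (3 : ℝ) ≤ n := by exact_mod_cast h3
  have hN0 : (0 : ℝ) < n := by linarith
  have hbr : (b : ℝ) ≤ 1 := by exact_mod_cast hb
  have hb0 : (0 : ℝ) ≤ b := by positivity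
  set N : ℝ := (n : ℝ)
  set c : ℝ := (b : ℝ)
  have hεN : 11 ≤ ε * N := by
    rw [div_le_iff₀ hε] at hn; linarith
  -- clear denominators
  have e1 : (3 * (c + 1) - 16 / N ^ 2) * B ≤ (2 * (c + 1) * N + 4) * (N * M4) := by
    have a1 : 0 ≤ 4 * (2 - (c + 1)) / N := div_nonneg (by linarith) hN0.le
    have a2 : 0 ≤ 8 / N := by positivity
    have a3 : 0 ≤ N * M4 := by positivity
    nlinarith [mul_nonneg a1 hB, mul_nonneg a2 a3, mul_nonneg hb0 a3]
  have a4 : 0 ≤ 3 * (c + 1) - 16 / N ^ 2 := by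
    have : 16 / N ^ 2 ≤ 3 := by
      rw [div_le_iff₀ (by positivity)]; nlinarith
    linarith
  have e2 : (3 * (c + 1) - 16 / N ^ 2) * (N * M2) ^ 2 ≤ (2 * (c + 1) * N + 4) * (N * M4) * Z :=
    calc _ ≤ (3 * (c + 1) - 16 / N ^ 2) * (B * Z) := mul_le_mul_of_nonneg_left hcs a4
      _ = (3 * (c + 1) - 16 / N ^ 2) * B * Z := by ring
      _ ≤ _ := mul_le_mul_of_nonneg_right e1 hZ.le
  have e3 : (3 / 2 - ε) * (2 * (c + 1) * N + 4) ≤ (3 * (c + 1) - 16 / N ^ 2) * N := by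
    have : 16 / N ^ 2 * N ≤ 16 := by
      rw [div_mul_eq_mul_div, div_le_iff₀ (by positivity)]
      nlinarith
    nlinarith [mul_nonneg hb0 (mul_pos hε hN0).le]
  have e4 : (3 / 2 - ε) * M2 ^ 2 ≤ M4 * Z := by
    have hpos : 0 < (2 * (c + 1) * N + 4) * N := by positivity
    refine le_of_mul_le_mul_left ?_ hpos
    calc (2 * (c + 1) * N + 4) * N * ((3 / 2 - ε) * M2 ^ 2)
        = ((3 / 2 - ε) * (2 * (c + 1) * N + 4)) * (N * M2 ^ 2) := by ring
      _ ≤ ((3 * (c + 1) - 16 / N ^ 2) * N) * (N * M2 ^ 2) :=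
          mul_le_mul_of_nonneg_right e3 (by positivity)
      _ = (3 * (c + 1) - 16 / N ^ 2) * (N * M2) ^ 2 := by ring
      _ ≤ _ := e2
      _ = _ := by ring
  rw [div_pow, ← mul_div_assoc, div_le_div_iff₀ (by positivity) hZ]
  calc (3 / 2 - ε) * M2 ^ 2 * Z ≤ M4 * Z * Z := mul_le_mul_of_nonneg_right e4 hZ.le
    _ = _ := by ring

/-- inequality (5) of the paper. For `β ∈ {1,2}` and the density
`f_{2,β,β-1} e^{-‖x‖_p^p}`: for every `ε > 0` there is `N` such that for all `n ≥ N` and all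
`p ≥ 1`, `M_p(x₁⁴)/M_p(1) ≥ (3/2 - ε) (M_p(x₁²)/M_p(1))²`. -/
theorem statement14 (β : ℕ) (hβ : β = 1 ∨ β = 2) :
    ∀ ε : ℝ, 0 < ε → ∃ N : ℕ,
      ∀ (n : ℕ) (hN : N ≤ n) (hn : 1 ≤ n) (p : ℝ), 1 ≤ p →
        (3 / 2 - ε) *
            (Mp n 2 β (β - 1) p (fun x => x ⟨0, by omega⟩ ^ 2) /
              Mp n 2 β (β - 1) p (fun _ => 1)) ^ 2 ≤
          Mp n 2 β (β - 1) p (fun x => x ⟨0, by omega⟩ ^ 4) /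
            Mp n 2 β (β - 1) p (fun _ => 1) := by
  intro ε hε
  refine ⟨max 3 ⌈11 / ε⌉₊, ?_⟩
  intro n hN hn p hp
  have h3 : 3 ≤ n := le_trans (le_max_left _ _) hN
  have h11 : 11 / ε ≤ n :=
    le_trans (Nat.le_ceil _) (by exact_mod_cast le_trans (le_max_right _ _) hN)
  rcases hβ with rfl | rfl
  · exact st_final n 0 (by norm_num) ε hε h3 h11 p hp _
  · exact st_final n 1 le_rfl ε hε h3 h11 p hp _
end
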